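/- Let q be a power of a prime and F_q the finite field with q elements. Let A ⊆ F_q with |A| ≥ 2, and suppose there is a constant C > 0 such that for every proper subfield G of F_q and all elements c, d ∈ F_q one has |A ∩ (cG + d)| ≤ C·max{|G|^{1/2}, |A|^{51/52}}. Then there is a constant C' > 0 depending only on C such that for every finite set L of lines in F_q^2, I(A × A, L) ≤ C'·((|A|^{173/104} + q^{-1/285}|A|^{476/285})·|L|^{2/3} + |L|). -/

import Mathlib

open scoped Classical Pointwise

noncomputable section

namespace STP

variable {F : Type} [Field F]

def collinearTriples (A B : Finset F) : ℕ :=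
  (((A ×ˢ A ×ˢ A) ×ˢ (B ×ˢ B ×ˢ B)).filter fun x =>
    (x.1.2.1 - x.1.1) * (x.2.2.2 - x.2.1) = (x.1.2.2 - x.1.1) * (x.2.2.1 - x.2.1)).card

def IsLine (l : Set (F × F)) : Prop :=
  ∃ a b c : F, (a, b) ≠ (0, 0) ∧ l = {p : F × F | a * p.1 + b * p.2 = c}

def incidences (P : Finset (F × F)) (L : Finset (Set (F × F))) : ℕ :=
  ((P ×ˢ L).filter fun x => x.1 ∈ x.2).card

def kIncidences (P : Finset (F × F)) (L : Finset (Set (F × F))) (k : ℕ) : ℕ :=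
  (((Fintype.piFinset fun _ : Fin k => P) ×ˢ L).filter fun x => ∀ i, x.1 i ∈ x.2).card

def numLines (P : Finset (F × F)) : ℕ :=
  Set.ncard {l : Set (F × F) | IsLine l ∧ 2 ≤ (P.filter (· ∈ l)).card}

def addEnergy (X Y : Finset F) : ℕ :=
  (((X ×ˢ X) ×ˢ (Y ×ˢ Y)).filter fun t => t.1.1 + t.2.1 = t.1.2 + t.2.2).card

def mulEnergy (A : Finset F) : ℕ :=
  (((A ×ˢ A) ×ˢ (A ×ˢ A)).filter fun t => t.1.1 * t.2.1 = t.1.2 * t.2.2).card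

def quotSet (X : Finset F) : Set F :=
  {r : F | ∃ x1 ∈ X, ∃ x2 ∈ X, ∃ x3 ∈ X, ∃ x4 ∈ X, x3 ≠ x4 ∧ r = (x1 - x2) / (x3 - x4)}

def subfieldCond (A : Finset F) (C bound : ℝ) : Prop :=
  ∀ G : Subfield F, G ≠ ⊤ → ∀ c d : F,
    ((A.filter fun x => ∃ g ∈ G, x = c * g + d).card : ℝ) ≤
      C * max ((Nat.card G : ℝ) ^ ((1:ℝ)/2)) bound

def linesOf [Fintype F] (P : Finset (F × F)) : Finset (Set (F × F)) :=
  Set.Finite.toFinset (Set.toFinite {l : Set (F × F) | IsLine l ∧ 2 ≤ (P.filter (· ∈ l)).card})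

def tripleCount [Fintype F] (P : Finset (F × F)) : ℕ :=
  ∑ l ∈ linesOf P, ((P.filter (· ∈ l)).card) ^ 3

lemma fiber_count {α β : Type*} (S : Finset β) (U : Finset α) (f : α → β) (t : ℝ)
    (h : ∀ z ∈ S, t ≤ ((U.filter (fun u => f u = z)).card : ℝ)) :
    (S.card : ℝ) * t ≤ U.card := by
  have h1 : ∑ z ∈ S, (U.filter (fun u => f u = z)).card ≤ U.card := by
    rw [← Finset.card_biUnion]
    · apply Finset.card_le_card
      intro x hx
      simp only [Finset.mem_biUnion, Finset.mem_filter] at hx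
      obtain ⟨_, _, h, _⟩ := hx
      exact h
    · intro x _ y _ hxy
      rw [Function.onFun, Finset.disjoint_left]
      intro a ha hb
      simp only [Finset.mem_filter] at ha hb
      exact hxy (ha.2.symm.trans hb.2)
  calc (S.card : ℝ) * t = ∑ z ∈ S, t := by simp
    _ ≤ ∑ z ∈ S, ((U.filter (fun u => f u = z)).card : ℝ) := Finset.sum_le_sum h
    _ ≤ U.card := by exact_mod_cast h1

lemma card_filter_prod {α β : Type*} (S : Finset α) (T : Finset β) (r : α → β → Prop) :
    ((S ×ˢ T).filter (fun x => r x.1 x.2)).card = ∑ a ∈ S, (T.filter (fun b => r a b)).card := by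
  simp only [Finset.card_filter]
  rw [Finset.sum_product]

lemma double_count {α β : Type*} (S : Finset α) (T : Finset β) (r : α → β → Prop) :
    ∑ a ∈ S, (T.filter (fun b => r a b)).card = ∑ b ∈ T, (S.filter (fun a => r a b)).card := by
  simp only [Finset.card_filter]
  rw [Finset.sum_comm]

lemma markov_rel {α : Type*} (B : Finset α) (r : α → α → Prop) (ε : ℝ) (hε : 0 < ε)
    (h : (((B ×ˢ B).filter (fun x => r x.1 x.2)).card : ℝ) ≤ ε * (B.card : ℝ) ^ 2) :
    ((B.filter (fun v => 4 * ε * B.card < ((B.filter (fun u => r v u)).card : ℝ))).card : ℝ)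
      ≤ B.card / 4 := by
  rcases B.eq_empty_or_nonempty with rfl | hB
  · simp
  have hpos : (0 : ℝ) < B.card := by exact_mod_cast hB.card_pos
  rw [card_filter_prod] at h
  set X := B.filter (fun v => 4 * ε * B.card < ((B.filter (fun u => r v u)).card : ℝ)) with hX
  have h1 : (X.card : ℝ) * (4 * ε * B.card) ≤ ∑ a ∈ B, ((B.filter (fun u => r a u)).card : ℝ) := by
    calc (X.card : ℝ) * (4 * ε * B.card) = ∑ a ∈ X, (4 * ε * B.card) := by simp
      _ ≤ ∑ a ∈ X, ((B.filter (fun u => r a u)).card : ℝ) := by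
        apply Finset.sum_le_sum
        intro a ha
        exact (Finset.mem_filter.1 ha).2.le
      _ ≤ _ := by
        apply Finset.sum_le_sum_of_subset_of_nonneg (Finset.filter_subset _ _)
        intros; positivity
  push_cast at h
  have h2 : (X.card : ℝ) * 4 * (ε * B.card) ≤ B.card * (ε * B.card) := by nlinarith
  have := le_of_mul_le_mul_right h2 (by positivity)
  linarith

lemma ar1 (e m N : ℝ) (hm : m ≠ 0) (hN : N ≠ 0) :
    N ^ 2 * (e ^ 2 / (256 * m * N ^ 2)) = e ^ 2 / (256 * m) := by
  field_simp

lemma ar2 (e m N ε : ℝ) (hm : m ≠ 0) (hN : N ≠ 0) :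
    N ^ 2 * (ε * (e ^ 2 / (16 * m * N ^ 2))) = ε * (e ^ 2 / (16 * m)) := by
  field_simp

lemma ar3 (e m : ℝ) (hm : m ≠ 0) : m * (e ^ 2 / (8 * m ^ 2)) = e ^ 2 / (8 * m) := by
  field_simp

set_option maxHeartbeats 1000000 in
lemma bsg_graph {α β : Type*} (W : Finset α) (B : Finset β) (r : α → β → Prop) (e m N ε : ℝ)
    (he : 0 < e) (hm : 0 < m) (hN : 0 < N) (hε : 0 < ε)
    (hW : (W.card : ℝ) ≤ m) (hB : (B.card : ℝ) ≤ N)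
    (hG : e ≤ ((∑ w ∈ W, (B.filter (fun v => r w v)).card : ℕ) : ℝ)) :
    ∃ B₁ ⊆ B, ∃ B' ⊆ B₁, (B₁.card : ℝ) ≤ 2 * B'.card ∧ e / (3 * m) ≤ B₁.card ∧
      (∀ v ∈ B', ((B₁.filter (fun u =>
        ((W.filter (fun w => r w v ∧ r w u)).card : ℝ) < e ^ 2 / (256 * m * N ^ 2))).card : ℝ)
          ≤ B₁.card / 4) ∧
      (∀ v ∈ B', ((B₁.filter (fun u =>
        ((W.filter (fun w => r w v ∧ r w u)).card : ℝ) < ε * (e ^ 2 / (16 * m * N ^ 2)))).card : ℝ)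
          ≤ 4 * ε * B₁.card) ∧
      (∀ v ∈ B', e / (2 * N) ≤ ((W.filter (fun w => r w v)).card : ℝ)) := by
  set B₀ := B.filter (fun v => e / (2 * N) ≤ ((W.filter (fun w => r w v)).card : ℝ)) with hB₀
  have hB₀N : (B₀.card : ℝ) ≤ N := le_trans (by exact_mod_cast Finset.card_filter_le _ _) hB
  set nb : α → Finset β := fun w => B₀.filter (fun v => r w v) with hnb
  set cod : β → β → ℝ := fun v u => ((W.filter (fun w => r w v ∧ r w u)).card : ℝ) with hcod
  have hedge : e / 2 ≤ ∑ w ∈ W, ((nb w).card : ℝ) := by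
    have h1 := double_count W B r
    have h2 := double_count W B₀ r
    have h3 : ∑ w ∈ W, ((nb w).card : ℝ) = ∑ v ∈ B₀, ((W.filter (fun w => r w v)).card : ℝ) := by
      exact_mod_cast h2
    rw [h1] at hG
    push_cast at hG
    rw [h3, hB₀]
    have h4 := Finset.sum_filter_add_sum_filter_not B
      (fun v => e / (2 * N) ≤ ((W.filter (fun w => r w v)).card : ℝ))
      (fun v => ((W.filter (fun w => r w v)).card : ℝ))
    have h5 : ∑ v ∈ B.filter (fun v => ¬ (e / (2 * N) ≤ ((W.filter (fun w => r w v)).card : ℝ))),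
        ((W.filter (fun w => r w v)).card : ℝ) ≤ e / 2 := by
      calc _ ≤ ∑ v ∈ B.filter (fun v => ¬ (e / (2 * N) ≤ ((W.filter (fun w => r w v)).card : ℝ))),
            (e / (2 * N)) := by
            apply Finset.sum_le_sum
            intro v hv
            exact (not_le.1 (Finset.mem_filter.1 hv).2).le
        _ = ((B.filter (fun v => ¬ (e / (2 * N) ≤ ((W.filter (fun w => r w v)).card : ℝ)))).card : ℝ)
              * (e / (2 * N)) := by simp
        _ ≤ N * (e / (2 * N)) := by
            gcongr
            exact le_trans (by exact_mod_cast Finset.card_filter_le _ _) hB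
        _ = e / 2 := by field_simp
    linarith
  have hbad : ∀ τ : ℝ, 0 ≤ τ → ∑ w ∈ W,
      (((nb w ×ˢ nb w).filter (fun x => cod x.1 x.2 < τ)).card : ℝ) ≤ N ^ 2 * τ := by
    intro τ hτ
    have h1 : ∀ w, (nb w ×ˢ nb w).filter (fun x => cod x.1 x.2 < τ) =
        ((B₀ ×ˢ B₀).filter (fun x => cod x.1 x.2 < τ)).filter (fun x => r w x.1 ∧ r w x.2) := by
      intro w
      ext ⟨a, b⟩
      simp only [hnb, Finset.mem_filter, Finset.mem_product]
      tauto
    simp only [h1]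
    have h2 := double_count W ((B₀ ×ˢ B₀).filter (fun x => cod x.1 x.2 < τ))
      (fun w x => r w x.1 ∧ r w x.2)
    have h3 : ∑ w ∈ W, ((((B₀ ×ˢ B₀).filter (fun x => cod x.1 x.2 < τ)).filter
        (fun x => r w x.1 ∧ r w x.2)).card : ℝ) =
        ∑ x ∈ (B₀ ×ˢ B₀).filter (fun x => cod x.1 x.2 < τ), cod x.1 x.2 := by
      have h2' := congrArg (Nat.cast : ℕ → ℝ) h2
      push_cast at h2'
      convert h2' <;> rfl
    rw [h3]
    calc _ ≤ ∑ x ∈ (B₀ ×ˢ B₀).filter (fun x => cod x.1 x.2 < τ), τ := by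
          apply Finset.sum_le_sum
          intro v hv
          exact (Finset.mem_filter.1 hv).2.le
      _ = (((B₀ ×ˢ B₀).filter (fun x => cod x.1 x.2 < τ)).card : ℝ) * τ := by simp
      _ ≤ N ^ 2 * τ := by
        gcongr
        calc (((B₀ ×ˢ B₀).filter (fun x => cod x.1 x.2 < τ)).card : ℝ) ≤ ((B₀ ×ˢ B₀).card : ℝ) := by
              exact_mod_cast Finset.card_filter_le _ _
          _ = (B₀.card : ℝ) ^ 2 := by rw [Finset.card_product]; push_cast; ring
          _ ≤ N ^ 2 := by gcongr
  have hnbsub : ∀ w, nb w ⊆ B₀ := fun w => Finset.filter_subset _ _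
  have hB₀d : ∀ v ∈ B₀, e / (2 * N) ≤ ((W.filter (fun w => r w v)).card : ℝ) :=
    fun v hv => (Finset.mem_filter.1 hv).2
  have hB₀s : B₀ ⊆ B := Finset.filter_subset _ _
  have hcod' : ∀ v u, ((W.filter (fun w => r w v ∧ r w u)).card : ℝ) = cod v u := fun _ _ => rfl
  simp only [hcod']
  clear_value nb cod B₀
  have hWne : W.Nonempty := by
    rw [Finset.nonempty_iff_ne_empty]
    rintro rfl
    simp at hedge
    linarith
  set τ₁ := e ^ 2 / (256 * m * N ^ 2) with hτ₁
  set τ₂ := ε * (e ^ 2 / (16 * m * N ^ 2)) with hτ₂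
  have hsq : e ^ 2 / (4 * m) ≤ ∑ w ∈ W, ((nb w).card : ℝ) ^ 2 := by
    have h := sq_sum_le_card_mul_sum_sq (s := W) (f := fun w => ((nb w).card : ℝ))
    have h0 : (e / 2) ^ 2 ≤ (∑ w ∈ W, ((nb w).card : ℝ)) ^ 2 :=
      pow_le_pow_left₀ (by positivity) hedge 2
    rw [div_le_iff₀ (by positivity)]
    have h1 : (0:ℝ) ≤ ∑ w ∈ W, ((nb w).card : ℝ) ^ 2 :=
      Finset.sum_nonneg (fun w _ => sq_nonneg _)
    have h2 : (W.card : ℝ) * ∑ w ∈ W, ((nb w).card : ℝ) ^ 2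
      ≤ m * ∑ w ∈ W, ((nb w).card : ℝ) ^ 2 := mul_le_mul_of_nonneg_right hW h1
    nlinarith
  have hb1 := hbad τ₁ (by positivity)
  have hb2 := hbad τ₂ (by positivity)
  have e1 : N ^ 2 * τ₁ = e ^ 2 / (256 * m) := by rw [hτ₁]; exact ar1 e m N hm.ne' hN.ne'
  have e2 : N ^ 2 * τ₂ = ε * (e ^ 2 / (16 * m)) := by rw [hτ₂]; exact ar2 e m N ε hm.ne' hN.ne'
  clear_value τ₁ τ₂
  rw [e1] at hb1
  rw [e2] at hb2
  obtain ⟨w, hw, hww⟩ : ∃ w ∈ W, e ^ 2 / (8 * m ^ 2) ≤ ((nb w).card : ℝ) ^ 2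
      - 16 * (((nb w ×ˢ nb w).filter (fun x => cod x.1 x.2 < τ₁)).card : ℝ)
      - ε⁻¹ * (((nb w ×ˢ nb w).filter (fun x => cod x.1 x.2 < τ₂)).card : ℝ) := by
    apply Finset.exists_le_of_sum_le hWne
    rw [Finset.sum_sub_distrib, Finset.sum_sub_distrib, ← Finset.mul_sum, ← Finset.mul_sum]
    have h1 : ∑ w ∈ W, e ^ 2 / (8 * m ^ 2) ≤ e ^ 2 / (8 * m) := by
      rw [Finset.sum_const, nsmul_eq_mul]
      calc _ ≤ m * (e ^ 2 / (8 * m ^ 2)) := by gcongr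
        _ = _ := ar3 e m hm.ne'
    have h2 := mul_le_mul_of_nonneg_left hb2 (inv_nonneg.2 hε.le)
    rw [inv_mul_cancel_left₀ hε.ne'] at h2
    have h3 : e ^ 2 / (4 * m) = 4 * (e ^ 2 / (16 * m)) := by ring
    have h4 : e ^ 2 / (8 * m) = 2 * (e ^ 2 / (16 * m)) := by ring
    have h5 : e ^ 2 / (16 * m) = 16 * (e ^ 2 / (256 * m)) := by ring
    linarith
  have q0 : (0:ℝ) ≤ e ^ 2 / (8 * m ^ 2) := by positivity
  have q1 : (0:ℝ) ≤ (((nb w ×ˢ nb w).filter (fun x => cod x.1 x.2 < τ₁)).card : ℝ) := by positivity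
  have q2 : (0:ℝ) ≤ ε⁻¹ * (((nb w ×ˢ nb w).filter (fun x => cod x.1 x.2 < τ₂)).card : ℝ) := by
    positivity
  have k1 := markov_rel (nb w) (fun a b => cod a b < τ₁) (1/16) (by norm_num) (by linarith)
  have k2 := markov_rel (nb w) (fun a b => cod a b < τ₂) ε hε (by
    have : ε⁻¹ * (((nb w ×ˢ nb w).filter (fun x => cod x.1 x.2 < τ₂)).card : ℝ)
      ≤ ((nb w).card : ℝ) ^ 2 := by linarith
    rwa [inv_mul_le_iff₀ hε] at this)
  set V1 := (nb w).filter (fun v => 4 * (1/16) * ((nb w).card : ℝ) <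
    (((nb w).filter (fun u => cod v u < τ₁)).card : ℝ)) with hV1
  set V2 := (nb w).filter (fun v => 4 * ε * ((nb w).card : ℝ) <
    (((nb w).filter (fun u => cod v u < τ₂)).card : ℝ)) with hV2
  refine ⟨nb w, (hnbsub w).trans hB₀s,
    (nb w) \ (V1 ∪ V2), Finset.sdiff_subset, ?_, ?_, ?_, ?_, ?_⟩
  · have h1 : ((nb w).card : ℝ) ≤ ((nb w \ (V1 ∪ V2)).card : ℝ) + (V1 ∪ V2).card := by
      have := Finset.le_card_sdiff (V1 ∪ V2) (nb w)
      have : (nb w).card ≤ (nb w \ (V1 ∪ V2)).card + (V1 ∪ V2).card := by omega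
      exact_mod_cast this
    have h2 : ((V1 ∪ V2).card : ℝ) ≤ V1.card + V2.card := by
      exact_mod_cast Finset.card_union_le _ _
    linarith
  · apply le_of_sq_le_sq _ (by positivity)
    calc (e / (3 * m)) ^ 2 = e ^ 2 / (9 * m ^ 2) := by rw [div_pow]; ring
      _ ≤ e ^ 2 / (8 * m ^ 2) := by gcongr; norm_num
      _ ≤ _ := by linarith
  · intro v hv
    simp only [hV1, hV2, Finset.mem_sdiff, Finset.mem_union, Finset.mem_filter, not_or, not_and,
      not_lt] at hv
    have := hv.2.1 hv.1
    linarith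
  · intro v hv
    simp only [hV1, hV2, Finset.mem_sdiff, Finset.mem_union, Finset.mem_filter, not_or, not_and,
      not_lt] at hv
    exact hv.2.2 hv.1
  · intro v hv
    have h1 := (Finset.mem_sdiff.1 hv).1
    exact hB₀d v (hnbsub w h1)

lemma diff_bound {F : Type*} [Field F] (W1 W2 B₁ B' : Finset F) (r : F → F → Prop) (d : F)
    (hd : d ≠ 0) (hr : ∀ w ∈ W1, ∀ v ∈ B₁, r w v → w - d * v ∈ W2) (hB : B' ⊆ B₁) (τ : ℝ)
    (hτ : 0 < τ)
    (h : ∀ v ∈ B', ((B₁.filter (fun u =>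
        ((W1.filter (fun w => r w v ∧ r w u)).card : ℝ) < τ)).card : ℝ) ≤ B₁.card / 4) :
    ((B' - B').card : ℝ) * ((B₁.card : ℝ) / 2 * τ ^ 2) ≤ (W2.card : ℝ) ^ 4 := by
  have key := fiber_count (B' - B') (W2 ×ˢ W2 ×ˢ W2 ×ˢ W2)
    (fun p => (p.1 - p.2.1 + p.2.2.1 - p.2.2.2) / d) ((B₁.card : ℝ) / 2 * τ ^ 2) ?_
  · refine key.trans (le_of_eq ?_)
    simp only [Finset.card_product]; push_cast; ring
  intro z hz
  obtain ⟨v, hv, v', hv', rfl⟩ := Finset.mem_sub.1 hz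
  let good := B₁.filter (fun u => ¬ (((W1.filter (fun w => r w v ∧ r w u)).card : ℝ) < τ) ∧
      ¬ (((W1.filter (fun w => r w v' ∧ r w u)).card : ℝ) < τ))
  have hgood : (B₁.card : ℝ) / 2 ≤ good.card := by
    have h1 := h v hv
    have h2 := h v' hv'
    have h3 : B₁ ⊆ good ∪ (B₁.filter (fun u =>
        ((W1.filter (fun w => r w v ∧ r w u)).card : ℝ) < τ) ∪ B₁.filter (fun u =>
        ((W1.filter (fun w => r w v' ∧ r w u)).card : ℝ) < τ)) := by
      intro u hu
      simp only [good, Finset.mem_union, Finset.mem_filter]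
      tauto
    have h4 : (B₁.card : ℝ) ≤ good.card + ((B₁.filter (fun u =>
        ((W1.filter (fun w => r w v ∧ r w u)).card : ℝ) < τ)).card + (B₁.filter (fun u =>
        ((W1.filter (fun w => r w v' ∧ r w u)).card : ℝ) < τ)).card) := by
      have := (Finset.card_le_card h3).trans ((Finset.card_union_le _ _).trans
        (Nat.add_le_add_left (Finset.card_union_le _ _) _))
      exact_mod_cast this
    linarith
  let S := good.sigma (fun u => (W1.filter (fun w => r w v ∧ r w u)) ×ˢ
    (W1.filter (fun w => r w v' ∧ r w u)))
  have hS : (B₁.card : ℝ) / 2 * τ ^ 2 ≤ S.card := by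
    rw [Finset.card_sigma]
    push_cast [Finset.card_product]
    calc (B₁.card : ℝ) / 2 * τ ^ 2 ≤ good.card * τ ^ 2 := by gcongr
      _ = ∑ u ∈ good, τ ^ 2 := by simp
      _ ≤ _ := by
        apply Finset.sum_le_sum
        intro u hu
        have := (Finset.mem_filter.1 hu).2
        rw [pow_two]
        apply mul_le_mul (not_lt.1 this.1) (not_lt.1 this.2) hτ.le (by positivity)
  refine hS.trans ?_
  norm_cast
  apply Finset.card_le_card_of_injOn
    (fun x : (_ : F) × (F × F) => (x.2.1 - d * x.1, x.2.1 - d * v, x.2.2 - d * v', x.2.2 - d * x.1))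
  · rintro ⟨u, w, w'⟩ hx
    simp only [S, good, Finset.coe_sigma, Set.mem_sigma_iff, Finset.mem_coe, Finset.mem_filter,
      Finset.mem_product, Finset.coe_product, Set.mem_prod] at hx ⊢
    obtain ⟨⟨hu, -⟩, ⟨hw, h1, h2⟩, hw', h3, h4⟩ := hx
    refine ⟨⟨hr _ hw _ hu h2, hr _ hw _ (hB hv) h1, hr _ hw' _ (hB hv') h3, hr _ hw' _ hu h4⟩, ?_⟩
    field_simp
    ring
  · rintro ⟨u, w, w'⟩ - ⟨u1, w1, w1'⟩ - heq
    simp only [Prod.mk.injEq] at heq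
    obtain ⟨h1, h2, h3, h4⟩ := heq
    have e1 : w = w1 := by linear_combination h2
    have e2 : w' = w1' := by linear_combination h3
    subst e1 e2
    have e3 : u = u1 := by
      apply mul_left_cancel₀ hd
      linear_combination -h1
    subst e3
    rfl

lemma sub_bound {F : Type*} [Field F] (W1 W2 W' B₁ B' : Finset F) (r : F → F → Prop) (d : F)
    (hd : d ≠ 0) (hr : ∀ w ∈ W1, ∀ v ∈ B₁, r w v → w - d * v ∈ W2) (hB : B' ⊆ B₁) (hW : W' ⊆ W1)
    (τ h : ℝ) (hτ : 0 < τ) (hW' : ∀ w ∈ W', h ≤ ((B'.filter (r w)).card : ℝ))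
    (hh : ∀ v ∈ B', ((B₁.filter (fun u =>
        ((W1.filter (fun w => r w v ∧ r w u)).card : ℝ) < τ)).card : ℝ) ≤ h / 2) :
    ((W' - d • B').card : ℝ) * (h / 2 * τ) ≤ (W2.card : ℝ) ^ 3 := by
  have key := fiber_count (W' - d • B') (W2 ×ˢ W2 ×ˢ W2)
    (fun p => p.1 + p.2.1 - p.2.2) (h / 2 * τ) ?_
  · refine key.trans (le_of_eq ?_)
    simp only [Finset.card_product]; push_cast; ring
  intro z hz
  obtain ⟨w, hw, x, hx, rfl⟩ := Finset.mem_sub.1 hz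
  obtain ⟨v, hv, rfl⟩ := Finset.mem_smul_finset.1 hx
  let good := (B'.filter (r w)).filter (fun u => ¬ (((W1.filter (fun w => r w v ∧ r w u)).card : ℝ) < τ))
  have hgood : h / 2 ≤ good.card := by
    have h1 := hh v hv
    have h2 := hW' w hw
    have h3 : B'.filter (r w) ⊆ good ∪ (B₁.filter (fun u =>
        ((W1.filter (fun w => r w v ∧ r w u)).card : ℝ) < τ)) := by
      intro u hu
      have := hB (Finset.mem_filter.1 hu).1
      simp only [good, Finset.mem_union, Finset.mem_filter] at hu ⊢
      tauto
    have h4 : ((B'.filter (r w)).card : ℝ) ≤ good.card + (B₁.filter (fun u =>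
        ((W1.filter (fun w => r w v ∧ r w u)).card : ℝ) < τ)).card := by
      have := (Finset.card_le_card h3).trans ((Finset.card_union_le _ _))
      exact_mod_cast this
    linarith
  let S := good.sigma (fun u => (W1.filter (fun w => r w v ∧ r w u)))
  have hS : h / 2 * τ ≤ S.card := by
    rw [Finset.card_sigma]
    push_cast
    calc h / 2 * τ ≤ good.card * τ := by gcongr
      _ = ∑ u ∈ good, τ := by simp
      _ ≤ _ := by
        apply Finset.sum_le_sum
        intro u hu
        have := (Finset.mem_filter.1 hu).2
        exact not_lt.1 this
  refine hS.trans ?_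
  norm_cast
  apply Finset.card_le_card_of_injOn
    (fun x : (_ : F) × F => (w - d * x.1, x.2 - d * v, x.2 - d * x.1))
  · rintro ⟨u, w''⟩ hx
    simp only [S, good, Finset.coe_sigma, Set.mem_sigma_iff, Finset.mem_coe, Finset.mem_filter,
      Finset.mem_product] at hx ⊢
    obtain ⟨⟨⟨hu, h0⟩, -⟩, hw'', h1, h2⟩ := hx
    refine ⟨⟨hr _ (hW hw) _ (hB hu) h0, hr _ hw'' _ (hB hv) h1, hr _ hw'' _ (hB hu) h2⟩, ?_⟩
    simp only [smul_eq_mul]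
    ring
  · rintro ⟨u, w⟩ - ⟨u1, w1⟩ - heq
    simp only [Prod.mk.injEq] at heq
    obtain ⟨h1, h2, h3⟩ := heq
    have e1 : w = w1 := by linear_combination h2
    subst e1
    have e3 : u = u1 := by
      apply mul_left_cancel₀ hd
      linear_combination -h1
    subst e3
    rfl

lemma ar4 (X b e m N : ℝ) (he : 0 < e) (hm : 0 < m) (hN : 0 < N) 
    (h : X * (b / 2 * (e ^ 2 / (256 * m * N ^ 2)) ^ 2) ≤ m ^ 4) :
    X * b ≤ 2 ^ 17 * m ^ 6 * N ^ 4 / e ^ 4 := by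
  rw [le_div_iff₀ (by positivity)]
  have : X * (b / 2 * (e ^ 2 / (256 * m * N ^ 2)) ^ 2) = (X * b * e ^ 4) / (2 ^ 17 * m ^ 2 * N ^ 4) := by
    field_simp; ring
  rw [this, div_le_iff₀ (by positivity)] at h
  calc _ ≤ _ := h
    _ = _ := by ring

lemma ar5 (X b e m N : ℝ) (he : 0 < e) (hm : 0 < m) (hN : 0 < N) 
    (h : X * (b * e / (4 * N * m) / 2 * (e / (64 * N * m) * (e ^ 2 / (16 * m * N ^ 2)))) ≤ m ^ 3) :
    X * b ≤ 2 ^ 17 * m ^ 6 * N ^ 4 / e ^ 4 := by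
  rw [le_div_iff₀ (by positivity)]
  have : X * (b * e / (4 * N * m) / 2 * (e / (64 * N * m) * (e ^ 2 / (16 * m * N ^ 2))))
     = (X * b * e ^ 4) / (2 ^ 13 * m ^ 3 * N ^ 4) := by
    field_simp; ring
  rw [this, div_le_iff₀ (by positivity)] at h
  calc _ ≤ _ := h
    _ = 2 ^ 13 * (m ^ 6 * N ^ 4) := by ring
    _ ≤ 2 ^ 17 * (m ^ 6 * N ^ 4) := by gcongr <;> norm_num
    _ = _ := by ring

lemma add_bsg {F : Type*} [Field F] (W1 W2 B : Finset F) (r : F → F → Prop) (d : F)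
    (hd : d ≠ 0) (hr : ∀ w ∈ W1, ∀ v ∈ B, r w v → w - d * v ∈ W2) (e m N : ℝ)
    (he : 0 < e) (hm : 0 < m) (hN : 0 < N) (hW1 : (W1.card : ℝ) ≤ m) (hW2 : (W2.card : ℝ) ≤ m)
    (hB : (B.card : ℝ) ≤ N)
    (hG : e ≤ ((∑ w ∈ W1, (B.filter (fun v => r w v)).card : ℕ) : ℝ)) :
    ∃ B' ⊆ B, ∃ W' ⊆ W1, e / (6 * m) ≤ B'.card ∧
      ((B' - B').card : ℝ) * B'.card ≤ 2 ^ 17 * m ^ 6 * N ^ 4 / e ^ 4 ∧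
      ((W' - d • B').card : ℝ) * B'.card ≤ 2 ^ 17 * m ^ 6 * N ^ 4 / e ^ 4 ∧
      B'.card * e / (4 * N) ≤ ∑ w ∈ W', ((B'.filter (fun v => r w v)).card : ℝ) := by
  obtain ⟨B₁, hB₁, B', hB', h1, h2, h3, h4, h5⟩ := bsg_graph W1 B r e m N (e / (64 * N * m)) he hm hN
    (by positivity) hW1 hB hG
  have hr' : ∀ w ∈ W1, ∀ v ∈ B₁, r w v → w - d * v ∈ W2 := fun w hw v hv => hr w hw v (hB₁ hv)
  have hbb : (B'.card : ℝ) ≤ B₁.card := by exact_mod_cast Finset.card_le_card hB'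
  let h : ℝ := B'.card * e / (4 * N * m)
  let W' := W1.filter (fun w => h ≤ ((B'.filter (r w)).card : ℝ))
  refine ⟨B', hB'.trans hB₁, W', Finset.filter_subset _ _, ?_, ?_, ?_, ?_⟩
  · have : e / (6 * m) = e / (3 * m) / 2 := by field_simp; norm_num
    rw [this]; linarith
  · have h6 := diff_bound W1 W2 B₁ B' r d hd hr' hB' _ (by positivity) h3
    apply ar4 _ _ e m N he hm hN
    refine le_trans ?_ (h6.trans (by gcongr))
    gcongr
  · have h6 := sub_bound W1 W2 W' B₁ B' r d hd hr' hB' (Finset.filter_subset _ _) _ h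
      (by positivity) (fun w hw => (Finset.mem_filter.1 hw).2) (fun v hv => (h4 v hv).trans ?_)
    · apply ar5 _ _ e m N he hm hN
      exact h6.trans (by gcongr)
    · calc 4 * (e / (64 * N * m)) * (B₁.card : ℝ) ≤ 4 * (e / (64 * N * m)) * (2 * B'.card) := by gcongr
        _ = _ := by simp only [h]; field_simp; norm_num
  · have h6 := double_count W1 B' r
    have h7 : B'.card * e / (2 * N) ≤ ∑ w ∈ W1, ((B'.filter (fun v => r w v)).card : ℝ) := by
      have h6' : ∑ w ∈ W1, ((B'.filter (fun v => r w v)).card : ℝ) = ∑ v ∈ B', ((W1.filter (fun w => r w v)).card : ℝ) := by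
        exact_mod_cast h6
      rw [h6']
      calc B'.card * e / (2 * N) = ∑ v ∈ B', e / (2 * N) := by simp; ring
        _ ≤ _ := Finset.sum_le_sum h5
    have h8 := Finset.sum_filter_add_sum_filter_not W1 (fun w => h ≤ ((B'.filter (r w)).card : ℝ))
      (fun w => ((B'.filter (fun v => r w v)).card : ℝ))
    have h9 : ∑ w ∈ W1.filter (fun w => ¬ h ≤ ((B'.filter (r w)).card : ℝ)),
       ((B'.filter (fun v => r w v)).card : ℝ) ≤ m * h := by
      calc _ ≤ ∑ w ∈ W1.filter (fun w => ¬ h ≤ ((B'.filter (r w)).card : ℝ)), h := by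
            apply Finset.sum_le_sum
            intro w hw
            exact (not_le.1 (Finset.mem_filter.1 hw).2).le
        _ = ((W1.filter (fun w => ¬ h ≤ ((B'.filter (r w)).card : ℝ))).card : ℝ) * h := by simp
        _ ≤ m * h := by
          gcongr
          exact le_trans (by exact_mod_cast Finset.card_filter_le _ _) hW1
    have h10 : m * h = B'.card * e / (4 * N) := by simp only [h]; field_simp
    have h11 : B'.card * e / (2 * N) = 2 * (B'.card * e / (4 * N)) := by field_simp; norm_num
    change _ ≤ ∑ w ∈ W1.filter (fun w => h ≤ ((B'.filter (r w)).card : ℝ)), _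
    linarith

lemma smul_fsub {F : Type*} [Field F] (a : F) (s t : Finset F) : a • (s - t) = a • s - a • t := by
  ext x
  simp only [Finset.mem_smul_finset, Finset.mem_sub]
  constructor
  · rintro ⟨_, ⟨y, hy, z, hz, rfl⟩, rfl⟩
    exact ⟨_, ⟨y, hy, rfl⟩, _, ⟨z, hz, rfl⟩, (smul_sub _ _ _).symm⟩
  · rintro ⟨_, ⟨y, hy, rfl⟩, _, ⟨z, hz, rfl⟩, rfl⟩
    exact ⟨_, ⟨y, hy, z, hz, rfl⟩, smul_sub _ _ _⟩

lemma smul_fadd {F : Type*} [Field F] (a : F) (s t : Finset F) : a • (s + t) = a • s + a • t := by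
  ext x
  simp only [Finset.mem_smul_finset, Finset.mem_add]
  constructor
  · rintro ⟨_, ⟨y, hy, z, hz, rfl⟩, rfl⟩
    exact ⟨_, ⟨y, hy, rfl⟩, _, ⟨z, hz, rfl⟩, (smul_add _ _ _).symm⟩
  · rintro ⟨_, ⟨y, hy, rfl⟩, _, ⟨z, hz, rfl⟩, rfl⟩
    exact ⟨_, ⟨y, hy, z, hz, rfl⟩, smul_add _ _ _⟩

lemma extract_D {F : Type*} [Field F] (W' B' A1 : Finset F) (r : F → F → Prop) (e N : ℝ)
    (hN : 0 < N) (hB0 : ∀ v ∈ B', v ≠ 0) (hBne : B'.Nonempty) (he : 0 < e)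
    (hA : (A1.card : ℝ) ≤ N)
    (hr : ∀ w ∈ W', ∀ v ∈ B', r w v → w / v ∈ A1)
    (hG : B'.card * e / (4 * N) ≤ ∑ w ∈ W', ((B'.filter (fun v => r w v)).card : ℝ)) :
    ∃ v0 ∈ B', ∃ D ⊆ A1, e / (8 * N) ≤ D.card ∧ (∀ a ∈ D, a * v0 ∈ W') ∧
      ∀ a ∈ D, B'.card * e / (8 * N ^ 2) ≤ ((B'.filter (fun v => a * v ∈ W')).card : ℝ) := by
  have hBp : (0 : ℝ) < B'.card := by exact_mod_cast hBne.card_pos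
  have h1 : ∑ w ∈ W', ((B'.filter (fun v => r w v)).card : ℝ) ≤
      ∑ a ∈ A1, ((B'.filter (fun v => a * v ∈ W')).card : ℝ) := by
    have := card_filter_prod W' B' r
    have h2 : ((A1 ×ˢ B').filter (fun x => x.1 * x.2 ∈ W')).card =
        ∑ a ∈ A1, (B'.filter (fun v => a * v ∈ W')).card := by
      convert card_filter_prod A1 B' (fun a v => a * v ∈ W')
    have h3 : ((W' ×ˢ B').filter (fun x => r x.1 x.2)).card ≤
      ((A1 ×ˢ B').filter (fun x => x.1 * x.2 ∈ W')).card := by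
      apply Finset.card_le_card_of_injOn (fun x => (x.1 / x.2, x.2))
      · rintro ⟨w, v⟩ hx
        simp only [Finset.coe_filter, Finset.mem_product, Set.mem_ofPred_eq] at hx ⊢
        obtain ⟨⟨hw, hv⟩, h⟩ := hx
        refine ⟨⟨hr w hw v hv h, hv⟩, ?_⟩
        rwa [div_mul_cancel₀ _ (hB0 v hv)]
      · rintro ⟨w, v⟩ hx ⟨w1, v1⟩ _ heq
        simp only [Finset.coe_filter, Finset.mem_product, Set.mem_ofPred_eq] at hx
        simp only [Prod.mk.injEq] at heq ⊢
        obtain ⟨h4, rfl⟩ := heq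
        exact ⟨by have := hB0 v hx.1.2; field_simp at h4; exact h4, rfl⟩
    rw [this, h2] at h3
    exact_mod_cast h3
  let t : ℝ := B'.card * e / (8 * N ^ 2)
  let A2 := A1.filter (fun a => t ≤ ((B'.filter (fun v => a * v ∈ W')).card : ℝ))
  have h8 := Finset.sum_filter_add_sum_filter_not A1
      (fun a => t ≤ ((B'.filter (fun v => a * v ∈ W')).card : ℝ))
      (fun a => ((B'.filter (fun v => a * v ∈ W')).card : ℝ))
  have h9 : ∑ a ∈ A1.filter (fun a => ¬ t ≤ ((B'.filter (fun v => a * v ∈ W')).card : ℝ)),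
       ((B'.filter (fun v => a * v ∈ W')).card : ℝ) ≤ N * t := by
    calc _ ≤ ∑ a ∈ A1.filter (fun a => ¬ t ≤ ((B'.filter (fun v => a * v ∈ W')).card : ℝ)), t := by
            apply Finset.sum_le_sum
            intro w hw
            exact (not_le.1 (Finset.mem_filter.1 hw).2).le
        _ = ((A1.filter (fun a => ¬ t ≤ ((B'.filter (fun v => a * v ∈ W')).card : ℝ))).card : ℝ) * t := by simp
        _ ≤ N * t := by
          gcongr
          exact le_trans (by exact_mod_cast Finset.card_filter_le _ _) hA
  have h10 : N * t = B'.card * e / (8 * N) := by simp only [t]; field_simp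
  have h11 : B'.card * e / (4 * N) = 2 * (B'.card * e / (8 * N)) := by field_simp; norm_num
  have h12 : B'.card * e / (8 * N) ≤ ∑ a ∈ A2, ((B'.filter (fun v => a * v ∈ W')).card : ℝ) := by
    change _ ≤ ∑ a ∈ A1.filter (fun a => t ≤ ((B'.filter (fun v => a * v ∈ W')).card : ℝ)), _
    linarith
  have h13 : ∑ a ∈ A2, ((B'.filter (fun v => a * v ∈ W')).card : ℝ) =
      ∑ v ∈ B', ((A2.filter (fun a => a * v ∈ W')).card : ℝ) := by
    norm_cast
    convert double_count A2 B' (fun a v => a * v ∈ W')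
  rw [h13] at h12
  have h14 : ∑ v ∈ B', e / (8 * N) ≤ ∑ v ∈ B', ((A2.filter (fun a => a * v ∈ W')).card : ℝ) := by
    refine le_trans (le_of_eq ?_) h12
    simp; ring
  obtain ⟨v0, hv0, h15⟩ := Finset.exists_le_of_sum_le hBne h14
  refine ⟨v0, hv0, A2.filter (fun a => a * v0 ∈ W'),
    (Finset.filter_subset _ _).trans (Finset.filter_subset _ _), h15, ?_, ?_⟩
  · intro a ha
    exact (Finset.mem_filter.1 ha).2
  · intro a ha
    exact (Finset.mem_filter.1 (Finset.mem_filter.1 ha).1).2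

lemma ruzsa_D {F : Type*} [Field F] (W' B' : Finset F) (a d : F) (ha : a ≠ 0) (hd : d ≠ 0) :
    ((d • B' - a • B').card : ℝ) * ((B'.filter (fun v => a * v ∈ W')).card : ℝ) ≤
      ((W' - d • B').card : ℝ) * ((B' - B').card : ℝ) := by
  let Y := a • (B'.filter (fun v => a * v ∈ W'))
  have hY : Y.card = (B'.filter (fun v => a * v ∈ W')).card := Finset.card_smul_finset₀ ha _
  have h1 := Finset.ruzsa_triangle_inequality_sub_sub_sub (d • B') Y (a • B')
  have h2 : (d • B' - Y).card ≤ (W' - d • B').card := by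
    rw [← Finset.card_neg (d • B' - Y), neg_sub]
    apply Finset.card_le_card
    apply Finset.sub_subset_sub_right
    intro y hy
    obtain ⟨v, hv, rfl⟩ := Finset.mem_smul_finset.1 hy
    exact (Finset.mem_filter.1 hv).2
  have h3 : (a • B' - Y).card ≤ (B' - B').card := by
    rw [← Finset.card_smul_finset₀ ha (B' - B'), smul_fsub]
    apply Finset.card_le_card
    apply Finset.sub_subset_sub_left
    exact Finset.smul_finset_subset_smul_finset (Finset.filter_subset _ _)
  rw [← hY]
  have := h1.trans (Nat.mul_le_mul h2 h3)
  exact_mod_cast this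

lemma four_bound (D B : Finset F) (d : F) (M : ℝ) (hB : B.Nonempty) (hd : d ≠ 0)
    (hM : ∀ a ∈ D, ((d • B - a • B).card : ℝ) ≤ M * B.card) (ξ : F) (hξ : ξ ∈ quotSet D) :
    ((B + ξ • B).card : ℝ) ≤ 256 * M ^ 4 * B.card := by
  obtain ⟨a1, h1, a2, h2, a3, h3, a4, h4, hne, rfl⟩ := hξ
  have hβ : a3 - a4 ≠ 0 := sub_ne_zero.2 hne
  have hBp : (0 : ℝ) < B.card := by exact_mod_cast hB.card_pos
  let C := a1 • B ∪ (a2 • B ∪ (a3 • B ∪ a4 • B))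
  have hC : ((d • B - C).card : ℝ) ≤ 4 * M * B.card := by
    have e1 : d • B - C = (d • B - a1 • B) ∪ ((d • B - a2 • B) ∪ ((d • B - a3 • B) ∪ (d • B - a4 • B))) := by
      simp only [C, Finset.sub_union]
    have e2 : (d • B - C).card ≤ (d • B - a1 • B).card + ((d • B - a2 • B).card + ((d • B - a3 • B).card + (d • B - a4 • B).card)) := by
      rw [e1]
      refine (Finset.card_union_le _ _).trans (Nat.add_le_add_left ?_ _)
      refine (Finset.card_union_le _ _).trans (Nat.add_le_add_left ?_ _)
      exact (Finset.card_union_le _ _)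
    have e3 : ((d • B - C).card : ℝ) ≤ (d • B - a1 • B).card + ((d • B - a2 • B).card + ((d • B - a3 • B).card + (d • B - a4 • B).card)) := by
      exact_mod_cast e2
    linarith [hM a1 h1, hM a2 h2, hM a3 h3, hM a4 h4]
  have hP := Finset.pluennecke_ruzsa_inequality_nsmul_sub_nsmul_sub (A := d • B)
    hB.smul_finset C 2 2
  have hcd : (d • B).card = B.card := Finset.card_smul_finset₀ hd _
  rw [hcd] at hP
  have hP' : ((2 • C - 2 • C).card : ℝ) ≤ (((d • B - C).card : ℝ) / B.card) ^ 4 * B.card := by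
    have := (NNRat.cast_le (K := ℝ)).2 hP
    push_cast at this
    exact this
  have hsub : (a3 - a4) • (B + ((a1 - a2) / (a3 - a4)) • B) ⊆ 2 • C - 2 • C := by
    intro x hx
    obtain ⟨y, hy, rfl⟩ := Finset.mem_smul_finset.1 hx
    obtain ⟨b, hb, z, hz, rfl⟩ := Finset.mem_add.1 hy
    obtain ⟨b', hb', rfl⟩ := Finset.mem_smul_finset.1 hz
    have m1 : a1 * b' ∈ C := by
      simp only [C, Finset.mem_union]; left; exact Finset.mem_smul_finset.2 ⟨b', hb', rfl⟩
    have m2 : a2 * b' ∈ C := by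
      simp only [C, Finset.mem_union]; right; left; exact Finset.mem_smul_finset.2 ⟨b', hb', rfl⟩
    have m3 : a3 * b ∈ C := by
      simp only [C, Finset.mem_union]; right; right; left; exact Finset.mem_smul_finset.2 ⟨b, hb, rfl⟩
    have m4 : a4 * b ∈ C := by
      simp only [C, Finset.mem_union]; right; right; right; exact Finset.mem_smul_finset.2 ⟨b, hb, rfl⟩
    rw [two_nsmul]
    refine Finset.mem_sub.2 ⟨_, Finset.add_mem_add m3 m1, _, Finset.add_mem_add m4 m2, ?_⟩
    simp only [smul_eq_mul]
    field_simp
    ring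
  have hc := Finset.card_le_card hsub
  rw [Finset.card_smul_finset₀ hβ] at hc
  have hc' : ((B + ((a1 - a2) / (a3 - a4)) • B).card : ℝ) ≤ ((2 • C - 2 • C).card : ℝ) := by exact_mod_cast hc
  refine hc'.trans (hP'.trans ?_)
  have : ((d • B - C).card : ℝ) / B.card ≤ 4 * M := by
    rw [div_le_iff₀ hBp]; exact hC
  calc _ ≤ (4 * M) ^ 4 * (B.card : ℝ) := by gcongr
    _ = _ := by ring

lemma shift_mul (B : Finset F) (a d ξ : F) (hd : d ≠ 0) (hξ : ξ ≠ 0) :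
    ((B + (ξ * (a / d)) • B).card : ℝ) * B.card ≤ (B + ξ • B).card * (d • B - a • B).card := by
  have h := Finset.ruzsa_triangle_inequality_add_sub_add ((ξ * (a / d)) • B) (ξ • B) B
  have h1 : (ξ • B - (ξ * (a / d)) • B).card = (d • B - a • B).card := by
    have : ξ • B - (ξ * (a / d)) • B = (ξ / d) • (d • B - a • B) := by
      rw [smul_fsub, smul_smul, smul_smul]
      congr 2
      · field_simp
      · field_simp
    rw [this, Finset.card_smul_finset₀ (by positivity)]
  rw [h1, Finset.card_smul_finset₀ hξ, add_comm, add_comm (ξ • B)] at h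
  have h' : (B.card : ℝ) * (B + (ξ * (a / d)) • B).card ≤ (d • B - a • B).card * (B + ξ • B).card := by
    exact_mod_cast h
  linarith

lemma shift_add (B : Finset F) (ξ : F) (M0 : ℝ) (hB : B.Nonempty)
    (h0 : ((B - B).card : ℝ) ≤ M0 * B.card) :
    ((B + (ξ + 1) • B).card : ℝ) ≤ M0 ^ 3 * (B + ξ • B).card := by
  have hBp : (0 : ℝ) < B.card := by exact_mod_cast hB.card_pos
  have h := Finset.ruzsa_triangle_inequality_add_sub_add (B + B) B (ξ • B)
  have hP := Finset.pluennecke_ruzsa_inequality_nsmul_sub_nsmul_sub (A := B) hB B 1 2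
  have hP' : ((1 • B - 2 • B).card : ℝ) ≤ (((B - B).card : ℝ) / B.card) ^ 3 * B.card := by
    have := (NNRat.cast_le (K := ℝ)).2 hP
    push_cast at this
    exact this
  rw [one_nsmul, two_nsmul] at hP'
  have hs : B + (ξ + 1) • B ⊆ B + B + ξ • B := by
    intro x hx
    obtain ⟨b, hb, z, hz, rfl⟩ := Finset.mem_add.1 hx
    obtain ⟨b', hb', rfl⟩ := Finset.mem_smul_finset.1 hz
    refine Finset.mem_add.2 ⟨b + b', Finset.add_mem_add hb hb', ξ * b',
      Finset.mem_smul_finset.2 ⟨b', hb', rfl⟩, ?_⟩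
    simp only [smul_eq_mul]; ring
  have hc : ((B + (ξ + 1) • B).card : ℝ) ≤ (B + B + ξ • B).card := by
    exact_mod_cast Finset.card_le_card hs
  have h' : (B.card : ℝ) * (B + B + ξ • B).card ≤ (B - (B + B)).card * (B + ξ • B).card := by
    exact_mod_cast h
  have hr : ((B - B).card : ℝ) / B.card ≤ M0 := by rw [div_le_iff₀ hBp]; exact h0
  have h3 : ((B - (B + B)).card : ℝ) ≤ M0 ^ 3 * B.card := hP'.trans (by gcongr)
  have h4 : (B.card : ℝ) * (B + (ξ + 1) • B).card ≤ B.card * (M0 ^ 3 * (B + ξ • B).card) := by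
    calc (B.card : ℝ) * (B + (ξ + 1) • B).card ≤ B.card * (B + B + ξ • B).card := by gcongr
      _ ≤ _ := h'
      _ ≤ M0 ^ 3 * B.card * (B + ξ • B).card := by gcongr
      _ = _ := by ring
  exact le_of_mul_le_mul_left h4 hBp

lemma D1_bound (D B W' : Finset F) (d v0 ξ : F) (hd : d ≠ 0) (hv0 : v0 ≠ 0) (hB : B.Nonempty)
    (hD : D.Nonempty) (hDW : ∀ a ∈ D, a * v0 ∈ W') (hξ : ξ ∉ quotSet D) :
    ((D.card : ℝ) * B.card / (W' - d • B).card) ^ 2 ≤ (B + ξ • B).card := by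
  obtain ⟨a0, ha0⟩ := hD
  have hne : (W' - d • B).Nonempty := ⟨_, Finset.sub_mem_sub (hDW a0 ha0)
    (Finset.smul_mem_smul_finset hB.choose_spec)⟩
  have hp : (0 : ℝ) < (W' - d • B).card := by exact_mod_cast hne.card_pos
  obtain ⟨t, ht, hcard⟩ := Finset.exists_le_card_fiber_of_nsmul_le_card_of_maps_to
    (s := D ×ˢ B) (t := W' - d • B) (f := fun x => x.1 * v0 - d * x.2)
    (b := (D.card : ℝ) * B.card / (W' - d • B).card)
    (by
      rintro ⟨a, b⟩ hx
      rw [Finset.mem_product] at hx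
      exact Finset.sub_mem_sub (hDW a hx.1) (Finset.smul_mem_smul_finset hx.2)) hne
    (by
      rw [nsmul_eq_mul, Finset.card_product]
      push_cast
      rw [mul_div_cancel₀ _ hp.ne'])
  let D1 := D.filter (fun a => ∃ b ∈ B, a * v0 - d * b = t)
  have h1 : (((D ×ˢ B).filter (fun x => x.1 * v0 - d * x.2 = t)).card : ℝ) ≤ D1.card := by
    norm_cast
    apply Finset.card_le_card_of_injOn Prod.fst
    · rintro ⟨a, b⟩ hx
      simp only [Finset.coe_filter, Finset.mem_product, Set.mem_ofPred_eq, D1] at hx ⊢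
      exact ⟨hx.1.1, b, hx.1.2, hx.2⟩
    · rintro ⟨a, b⟩ hx ⟨a', b'⟩ hx' heq
      simp only [Finset.coe_filter, Finset.mem_product, Set.mem_ofPred_eq] at hx hx' heq
      subst heq
      have : b = b' := by
        apply mul_left_cancel₀ hd
        linear_combination hx'.2 - hx.2
      rw [this]
  have h2 : D1.card ^ 2 ≤ (B + ξ • B).card := by
    rw [pow_two, ← Finset.card_product]
    apply Finset.card_le_card_of_injOn (fun x => (v0 * x.1 - t + ξ * (v0 * x.2 - t)) / d)
    · rintro ⟨a, b⟩ hx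
      simp only [Finset.coe_product, Set.mem_prod, Finset.mem_coe, D1, Finset.mem_filter] at hx ⊢
      obtain ⟨⟨_, b1, hb1, e1⟩, _, b2, hb2, e2⟩ := hx
      refine Finset.mem_add.2 ⟨b1, hb1, ξ * b2, Finset.smul_mem_smul_finset hb2, ?_⟩
      field_simp
      linear_combination -e1 - ξ * e2
    · rintro ⟨a, b⟩ hx ⟨a', b'⟩ hx' heq
      simp only [Finset.coe_product, Set.mem_prod, Finset.mem_coe, D1, Finset.mem_filter] at hx hx' heq
      have e1 : a - a' = ξ * (b' - b) := by
        apply mul_left_cancel₀ hv0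
        field_simp at heq
        linear_combination heq
      by_cases hb : b' = b
      · subst hb
        have : a = a' := by linear_combination e1
        rw [this]
      · exact absurd ⟨a, hx.1.1, a', hx'.1.1, b', hx'.2.1, b, hx.2.1, hb, by
          rw [eq_div_iff (sub_ne_zero.2 hb), e1]⟩ hξ
  have h3 := hcard.trans h1
  calc ((D.card : ℝ) * B.card / (W' - d • B).card) ^ 2 ≤ (D1.card : ℝ) ^ 2 := by gcongr
    _ ≤ _ := by exact_mod_cast h2

lemma finite_back [Fintype F] (S : Set F) (f : F → F) (hf : Function.Injective f)
    (h : ∀ x ∈ S, f x ∈ S) (y : F) (hy : f y ∈ S) : y ∈ S := by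
  have h1 : f '' S ⊆ S := by rintro _ ⟨x, hx, rfl⟩; exact h x hx
  have h2 : f '' S = S := Set.eq_of_subset_of_ncard_le h1
    (by rw [Set.ncard_image_of_injective _ hf]) (Set.toFinite _)
  rw [← h2] at hy
  obtain ⟨x, hx, hxy⟩ := hy
  rwa [← hf hxy]

lemma closed_subfield [Fintype F] (R T : Set F) (h0 : (0 : F) ∈ R) (hT : ∀ c ∈ T, c ≠ 0)
    (h1 : ∀ r ∈ R, r + 1 ∈ R) (hm : ∀ c ∈ T, ∀ r ∈ R, r * c ∈ R) :
    ∀ g ∈ Subfield.closure T, g ∈ R := by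
  let P : Set F := {x | ∀ r ∈ R, r + x ∈ R}
  have P1 : (1 : F) ∈ P := h1
  have P0 : (0 : F) ∈ P := fun r hr => by simpa using hr
  have Padd : ∀ x ∈ P, ∀ y ∈ P, x + y ∈ P := fun x hx y hy r hr => by
    rw [← add_assoc]; exact hy _ (hx _ hr)
  have Pneg : ∀ x ∈ P, -x ∈ P := fun x hx r hr => by
    apply finite_back R (fun y => y + x) (add_left_injective x) hx
    simpa using hr
  have Pmul : ∀ c ∈ T, ∀ x ∈ P, c * x ∈ P := fun c hc x hx r hr => by
    have hc0 := hT c hc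
    have h2 : r / c ∈ R := by
      apply finite_back R (fun y => y * c) (mul_left_injective₀ hc0) (hm c hc)
      simpa [hc0] using hr
    have h3 := hm c hc _ (hx _ h2)
    have h4 : (r / c + x) * c = r + c * x := by field_simp
    rwa [h4] at h3
  have key : ∀ g ∈ Subfield.closure T, ∀ x ∈ P, g * x ∈ P := by
    intro g hg
    induction hg using Subfield.closure_induction with
    | mem x hx => exact Pmul x hx
    | one => intro x hx; simpa using hx
    | add x y _ _ hx hy => intro z hz; rw [add_mul]; exact Padd _ (hx z hz) _ (hy z hz)
    | neg x _ hx => intro z hz; rw [neg_mul]; exact Pneg _ (hx z hz)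
    | inv x _ hx =>
      intro z hz
      by_cases h : x = 0
      · simpa [h] using P0
      · apply finite_back P (fun y => x * y) (mul_right_injective₀ h) hx
        simpa [h] using hz
    | mul x y _ _ hx hy => intro z hz; rw [mul_assoc]; exact hx _ (hy z hz)
  intro g hg
  have := key g hg 1 P1 0 h0
  simpa using this

lemma pivot [Fintype F] (D B W' : Finset F) (d v0 : F) (M M0 : ℝ) (hd : d ≠ 0) (hv0 : v0 ≠ 0)
    (hB : B.Nonempty) (hD : 2 ≤ D.card) (hDW : ∀ a ∈ D, a * v0 ∈ W') (hD0 : ∀ a ∈ D, a ≠ 0)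
    (hM : ∀ a ∈ D, ((d • B - a • B).card : ℝ) ≤ M * B.card)
    (h0 : ((B - B).card : ℝ) ≤ M0 * B.card) :
    (∃ G : Subfield F, (∀ a ∈ D, a / d ∈ G) ∧
      ∀ g ∈ G, ((B + g • B).card : ℝ) ≤ 256 * M ^ 4 * B.card) ∨
    ((D.card : ℝ) * B.card / (W' - d • B).card) ^ 2 ≤ 256 * M ^ 5 * B.card ∨
    ((D.card : ℝ) * B.card / (W' - d • B).card) ^ 2 ≤ 256 * M0 ^ 3 * M ^ 4 * B.card := by
  have hBp : (0 : ℝ) < B.card := by exact_mod_cast hB.card_pos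
  have hDne : D.Nonempty := Finset.card_pos.1 (by omega)
  obtain ⟨a1, h1, a2, h2, h12⟩ := Finset.one_lt_card.1 (show 1 < D.card by omega)
  have hR0 : (0 : F) ∈ quotSet D := ⟨a1, h1, a1, h1, a1, h1, a2, h2, h12, by simp⟩
  have hM0' : 0 ≤ M0 := by
    by_contra h
    have : (0 : ℝ) ≤ (B - B).card := by positivity
    have := mul_neg_of_neg_of_pos (not_le.1 h) hBp
    linarith
  by_cases hadd : ∀ r ∈ quotSet D, r + 1 ∈ quotSet D
  · by_cases hmul : ∀ c ∈ (fun a => a / d) '' (D : Set F), ∀ r ∈ quotSet D, r * c ∈ quotSet D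
    · left
      refine ⟨Subfield.closure ((fun a => a / d) '' (D : Set F)), ?_, ?_⟩
      · intro a ha
        exact Subfield.subset_closure ⟨a, ha, rfl⟩
      · intro g hg
        apply four_bound D B d M hB hd hM
        apply closed_subfield _ _ hR0 _ hadd hmul g hg
        rintro _ ⟨a, ha, rfl⟩
        exact div_ne_zero (hD0 a ha) hd
    · right; left
      push Not at hmul
      obtain ⟨_, ⟨a, ha, rfl⟩, ξ, hξ, hξ'⟩ := hmul
      have hξ0 : ξ ≠ 0 := by
        rintro rfl
        simp only [zero_mul] at hξ'
        exact hξ' hR0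
      refine (D1_bound D B W' d v0 _ hd hv0 hB hDne hDW hξ').trans ?_
      have e1 := shift_mul B a d ξ hd hξ0
      have e2 := four_bound D B d M hB hd hM ξ hξ
      have e3 := hM a ha
      apply le_of_mul_le_mul_right _ hBp
      calc _ ≤ _ := e1
        _ ≤ (256 * M ^ 4 * B.card) * (M * B.card) := by gcongr
        _ = _ := by ring
  · right; right
    push Not at hadd
    obtain ⟨ξ, hξ, hξ'⟩ := hadd
    refine (D1_bound D B W' d v0 _ hd hv0 hB hDne hDW hξ').trans ?_
    have e1 := shift_add B ξ M0 hB h0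
    have e2 := four_bound D B d M hB hd hM ξ hξ
    calc _ ≤ _ := e1
        _ ≤ M0 ^ 3 * (256 * M ^ 4 * B.card) := by gcongr
        _ = _ := by ring

lemma energy_smul (B : Finset F) (g : F) (hg : g ≠ 0) :
    B.card ^ 4 ≤ (B + g • B).card * (((B ×ˢ B) ×ˢ (B ×ˢ B)).filter
      (fun x => x.1.1 + g * x.2.1 = x.1.2 + g * x.2.2)).card := by
  have h := Finset.le_card_add_mul_addEnergy B (g • B)
  rw [Finset.card_smul_finset₀ hg] at h
  have h2 : B.addEnergy (g • B) ≤ (((B ×ˢ B) ×ˢ (B ×ˢ B)).filter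
      (fun x => x.1.1 + g * x.2.1 = x.1.2 + g * x.2.2)).card := by
    unfold Finset.addEnergy
    apply Finset.card_le_card_of_injOn (fun x => (x.1, (g⁻¹ * x.2.1, g⁻¹ * x.2.2)))
    · rintro ⟨⟨a, b⟩, c, e⟩ hx
      simp only [Finset.coe_filter, Finset.mem_product, Set.mem_ofPred_eq, Finset.mem_smul_finset] at hx ⊢
      obtain ⟨⟨⟨ha, hb⟩, ⟨c', hc, rfl⟩, ⟨e', he, rfl⟩⟩, hh⟩ := hx
      simp only [smul_eq_mul] at hh ⊢
      rw [inv_mul_cancel_left₀ hg, inv_mul_cancel_left₀ hg]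
      exact ⟨⟨⟨ha, hb⟩, hc, he⟩, hh⟩
    · rintro ⟨⟨a, b⟩, c, e⟩ _ ⟨⟨a', b'⟩, c', e'⟩ _ heq
      simp only [Prod.mk.injEq] at heq ⊢
      obtain ⟨⟨rfl, rfl⟩, h1, h2⟩ := heq
      have hgi := inv_ne_zero hg
      exact ⟨⟨rfl, rfl⟩, mul_left_cancel₀ hgi h1, mul_left_cancel₀ hgi h2⟩
  calc _ = B.card ^ 2 * B.card ^ 2 := by ring
    _ ≤ _ := h
    _ ≤ _ := Nat.mul_le_mul_left _ h2

lemma energy_sum (B S : Finset F) :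
    ∑ g ∈ S, (((B ×ˢ B) ×ˢ (B ×ˢ B)).filter
      (fun x => x.1.1 + g * x.2.1 = x.1.2 + g * x.2.2)).card ≤ S.card * B.card ^ 2 + B.card ^ 4 := by
  have h := double_count S ((B ×ˢ B) ×ˢ (B ×ˢ B)) (fun g x => x.1.1 + g * x.2.1 = x.1.2 + g * x.2.2)
  have h' : ∑ g ∈ S, (((B ×ˢ B) ×ˢ (B ×ˢ B)).filter
      (fun x => x.1.1 + g * x.2.1 = x.1.2 + g * x.2.2)).card = ∑ x ∈ (B ×ˢ B) ×ˢ (B ×ˢ B),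
      (S.filter (fun g => x.1.1 + g * x.2.1 = x.1.2 + g * x.2.2)).card := by
    convert h
  rw [h']
  have hb : ∀ x ∈ (B ×ˢ B) ×ˢ (B ×ˢ B), (S.filter (fun g => x.1.1 + g * x.2.1 = x.1.2 + g * x.2.2)).card
      ≤ (if x.1.1 = x.1.2 ∧ x.2.1 = x.2.2 then S.card else 0) + 1 := by
    rintro ⟨⟨a, b⟩, c, e⟩ _
    simp only
    split_ifs with hh
    · exact (Finset.card_filter_le _ _).trans (Nat.le_succ _)
    · rw [zero_add]
      apply Finset.card_le_one.2
      intro g hg g' hg'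
      have e1 := (Finset.mem_filter.1 hg).2
      have e2 := (Finset.mem_filter.1 hg').2
      by_cases hce : c = e
      · subst hce
        exact absurd ⟨add_right_cancel e1, rfl⟩ hh
      · apply mul_right_cancel₀ (sub_ne_zero.2 hce)
        linear_combination e1 - e2
  refine (Finset.sum_le_sum hb).trans ?_
  rw [Finset.sum_add_distrib]
  apply Nat.add_le_add
  · rw [← Finset.sum_filter, Finset.sum_const, smul_eq_mul, mul_comm]
    apply Nat.mul_le_mul_left
    rw [pow_two, ← Finset.card_product]
    apply Finset.card_le_card_of_injOn (fun x => (x.1.1, x.2.1))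
    · rintro ⟨⟨a, b⟩, c, e⟩ hx
      simp only [Finset.coe_filter, Finset.mem_product, Set.mem_ofPred_eq, Finset.coe_product, Set.mem_prod, Finset.mem_coe] at hx ⊢
      exact ⟨hx.1.1.1, hx.1.2.1⟩
    · rintro ⟨⟨a, b⟩, c, e⟩ hx ⟨⟨a', b'⟩, c', e'⟩ hx' heq
      simp only [Finset.coe_filter, Finset.mem_product, Set.mem_ofPred_eq] at hx hx'
      simp only [Prod.mk.injEq] at heq ⊢
      obtain ⟨rfl, rfl⟩ := heq
      obtain ⟨-, rfl, rfl⟩ := hx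
      obtain ⟨-, rfl, rfl⟩ := hx'
      simp
  · simp only [Finset.sum_const, smul_eq_mul, mul_one, Finset.card_product]
    apply le_of_eq; ring

lemma subfield_energy [Fintype F] (B : Finset F) (G : Subfield F) (K : ℝ) (hB : B.Nonempty)
    (h : ∀ g ∈ G, ((B + g • B).card : ℝ) ≤ K * B.card) :
    (B.card : ℝ) ≤ 2 * K ∨ (Nat.card G : ℝ) ≤ 3 * K * B.card := by
  have hBp : (1 : ℝ) ≤ B.card := by exact_mod_cast hB.card_pos
  have hK : 1 ≤ K := by
    have h1 := h 0 (zero_mem _)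
    have h2 : (B.card : ℝ) ≤ (B + (0 : F) • B).card := by
      exact_mod_cast Finset.card_le_card_add_right (hB.smul_finset (a := (0:F)))
    nlinarith
  by_cases hcase : (B.card : ℝ) ≤ 2 * K
  · exact Or.inl hcase
  right
  push Not at hcase
  let S := (Finset.univ.filter (fun g : F => g ∈ G)).erase 0
  have hcG : (Nat.card G : ℝ) = S.card + 1 := by
    have : Nat.card G = (Finset.univ.filter (fun g : F => g ∈ G)).card := by
      rw [Nat.card_eq_fintype_card, Fintype.card_subtype]
    rw [this]
    have := Finset.card_erase_add_one (s := Finset.univ.filter (fun g : F => g ∈ G)) (a := 0)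
      (by simp [zero_mem])
    exact_mod_cast this.symm
  have hsum := energy_sum B S
  have hlow : (S.card : ℝ) * ((B.card : ℝ) ^ 3 / K) ≤ ((∑ g ∈ S, (((B ×ˢ B) ×ˢ (B ×ˢ B)).filter
      (fun x => x.1.1 + g * x.2.1 = x.1.2 + g * x.2.2)).card : ℕ) : ℝ) := by
    push_cast
    calc (S.card : ℝ) * ((B.card : ℝ) ^ 3 / K) = ∑ g ∈ S, ((B.card : ℝ) ^ 3 / K) := by simp
      _ ≤ _ := by
        apply Finset.sum_le_sum
        intro g hg
        have hg0 : g ≠ 0 := (Finset.mem_erase.1 hg).1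
        have hgG : g ∈ G := (Finset.mem_filter.1 (Finset.mem_erase.1 hg).2).2
        have e1 := energy_smul B g hg0
        generalize (((B ×ˢ B) ×ˢ (B ×ˢ B)).filter
          (fun x => x.1.1 + g * x.2.1 = x.1.2 + g * x.2.2)).card = E at e1 ⊢
        have e2 : (B.card : ℝ) ^ 4 ≤ (B + g • B).card * E := by exact_mod_cast e1
        rw [div_le_iff₀ (by linarith)]
        apply le_of_mul_le_mul_right _ (by linarith : (0 : ℝ) < B.card)
        calc _ = (B.card : ℝ) ^ 4 := by ring
          _ ≤ _ := e2
          _ ≤ (K * B.card) * E := by gcongr; exact h g hgG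
          _ = _ := by ring
  have hsum' : ((∑ g ∈ S, (((B ×ˢ B) ×ˢ (B ×ˢ B)).filter
      (fun x => x.1.1 + g * x.2.1 = x.1.2 + g * x.2.2)).card : ℕ) : ℝ) ≤
      S.card * (B.card : ℝ) ^ 2 + (B.card : ℝ) ^ 4 := by exact_mod_cast hsum
  have hf := hlow.trans hsum'
  rw [hcG]
  generalize (S.card : ℝ) = s at hf ⊢
  generalize (B.card : ℝ) = b at *
  have hs : s ≤ 2 * K * b := by
    rw [← mul_div_assoc, div_le_iff₀ (by linarith)] at hf
    by_contra hc
    push Not at hc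
    have hs0 : 0 < s := lt_trans (by positivity) hc
    have e1 : s * b ≤ K * s + K * b ^ 2 := by
      apply le_of_mul_le_mul_right _ (show (0:ℝ) < b ^ 2 by positivity)
      linarith
    nlinarith
  nlinarith

lemma arA3 (e m N b L : ℝ) (he : 0 < e) (hm : 0 < m) (hN : 0 < N) (hb : 0 < b) (hL : 0 < L)
    (heb : e ≤ 6 * m * b) (hLe : L * e ^ 4 = 2 ^ 17 * m ^ 6 * N ^ 4)
    (h : (e / (8 * N) * b ^ 2 / L) ^ 2 ≤ 256 * (L / b ^ 2) ^ 3 * (8 * N ^ 2 * L ^ 2 / (e * b ^ 4)) ^ 4 * b) :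
    e ^ 83 ≤ 4 ^ 160 * m ^ 103 * N ^ 62 := by
  have e1 : (e / (8 * N) * b ^ 2 / L) ^ 2 = e ^ 2 * b ^ 4 / (64 * N ^ 2 * L ^ 2) := by
    field_simp; norm_num
  have e2 : 256 * (L / b ^ 2) ^ 3 * (8 * N ^ 2 * L ^ 2 / (e * b ^ 4)) ^ 4 * b
      = 2 ^ 20 * L ^ 11 * N ^ 8 / (e ^ 4 * b ^ 21) := by
    field_simp; norm_num
  rw [e1, e2, div_le_div_iff₀ (by positivity) (by positivity)] at h
  have h1 : e ^ 6 * b ^ 25 ≤ 2 ^ 26 * N ^ 10 * L ^ 13 := by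
    calc _ = e ^ 2 * b ^ 4 * (e ^ 4 * b ^ 21) := by ring
      _ ≤ _ := h
      _ = _ := by ring
  have h2 : e ^ 25 ≤ (6 * m * b) ^ 25 := by gcongr
  calc e ^ 83 = e ^ 58 * e ^ 25 := by ring
    _ ≤ e ^ 58 * (6 * m * b) ^ 25 := by gcongr
    _ = 6 ^ 25 * m ^ 25 * e ^ 52 * (e ^ 6 * b ^ 25) := by ring
    _ ≤ 6 ^ 25 * m ^ 25 * e ^ 52 * (2 ^ 26 * N ^ 10 * L ^ 13) := by gcongr
    _ = 6 ^ 25 * 2 ^ 26 * m ^ 25 * N ^ 10 * (L * e ^ 4) ^ 13 := by ring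
    _ = (6 ^ 25 * 2 ^ 26 * (2 ^ 17) ^ 13) * (m ^ 103 * N ^ 62) := by rw [hLe]; ring
    _ ≤ 4 ^ 160 * (m ^ 103 * N ^ 62) := by gcongr; norm_num
    _ = _ := by ring

lemma arA5 (e m N b L : ℝ) (he : 0 < e) (hm : 0 < m) (hN : 0 < N) (hb : 0 < b) (hL : 0 < L)
    (heb : e ≤ 6 * m * b) (hLe : L * e ^ 4 = 2 ^ 17 * m ^ 6 * N ^ 4)
    (h : (e / (8 * N) * b ^ 2 / L) ^ 2 ≤ 256 * (8 * N ^ 2 * L ^ 2 / (e * b ^ 4)) ^ 5 * b) :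
    e ^ 78 ≤ 4 ^ 160 * m ^ 95 * N ^ 60 := by
  have e1 : (e / (8 * N) * b ^ 2 / L) ^ 2 = e ^ 2 * b ^ 4 / (64 * N ^ 2 * L ^ 2) := by
    field_simp; norm_num
  have e2 : 256 * (8 * N ^ 2 * L ^ 2 / (e * b ^ 4)) ^ 5 * b
      = 2 ^ 23 * L ^ 10 * N ^ 10 / (e ^ 5 * b ^ 19) := by
    field_simp; norm_num
  rw [e1, e2, div_le_div_iff₀ (by positivity) (by positivity)] at h
  have h1 : e ^ 7 * b ^ 23 ≤ 2 ^ 29 * N ^ 12 * L ^ 12 := by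
    calc _ = e ^ 2 * b ^ 4 * (e ^ 5 * b ^ 19) := by ring
      _ ≤ _ := h
      _ = _ := by ring
  have h2 : e ^ 23 ≤ (6 * m * b) ^ 23 := by gcongr
  calc e ^ 78 = e ^ 55 * e ^ 23 := by ring
    _ ≤ e ^ 55 * (6 * m * b) ^ 23 := by gcongr
    _ = 6 ^ 23 * m ^ 23 * e ^ 48 * (e ^ 7 * b ^ 23) := by ring
    _ ≤ 6 ^ 23 * m ^ 23 * e ^ 48 * (2 ^ 29 * N ^ 12 * L ^ 12) := by gcongr
    _ = 6 ^ 23 * 2 ^ 29 * m ^ 23 * N ^ 12 * (L * e ^ 4) ^ 12 := by ring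
    _ = (6 ^ 23 * 2 ^ 29 * (2 ^ 17) ^ 12) * (m ^ 95 * N ^ 60) := by rw [hLe]; ring
    _ ≤ 4 ^ 160 * (m ^ 95 * N ^ 60) := by gcongr; norm_num
    _ = _ := by ring

lemma arB1 (e m N b L : ℝ) (he : 0 < e) (hm : 0 < m) (hN : 0 < N) (hb : 0 < b)
    (heb : e ≤ 6 * m * b) (hLe : L * e ^ 4 = 2 ^ 17 * m ^ 6 * N ^ 4)
    (h : b ≤ 2 * (256 * (8 * N ^ 2 * L ^ 2 / (e * b ^ 4)) ^ 4)) :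
    e ^ 53 ≤ 4 ^ 160 * m ^ 65 * N ^ 40 := by
  have e2 : 2 * (256 * (8 * N ^ 2 * L ^ 2 / (e * b ^ 4)) ^ 4)
      = 2 ^ 21 * L ^ 8 * N ^ 8 / (e ^ 4 * b ^ 16) := by
    field_simp; norm_num
  rw [e2, le_div_iff₀ (by positivity)] at h
  have h1 : e ^ 4 * b ^ 17 ≤ 2 ^ 21 * N ^ 8 * L ^ 8 := by
    calc _ = b * (e ^ 4 * b ^ 16) := by ring
      _ ≤ _ := h
      _ = _ := by ring
  have h2 : e ^ 17 ≤ (6 * m * b) ^ 17 := by gcongr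
  calc e ^ 53 = e ^ 36 * e ^ 17 := by ring
    _ ≤ e ^ 36 * (6 * m * b) ^ 17 := by gcongr
    _ = 6 ^ 17 * m ^ 17 * e ^ 32 * (e ^ 4 * b ^ 17) := by ring
    _ ≤ 6 ^ 17 * m ^ 17 * e ^ 32 * (2 ^ 21 * N ^ 8 * L ^ 8) := by gcongr
    _ = 6 ^ 17 * 2 ^ 21 * m ^ 17 * N ^ 8 * (L * e ^ 4) ^ 8 := by ring
    _ = (6 ^ 17 * 2 ^ 21 * (2 ^ 17) ^ 8) * (m ^ 65 * N ^ 40) := by rw [hLe]; ring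
    _ ≤ 4 ^ 160 * (m ^ 65 * N ^ 40) := by gcongr; norm_num
    _ = _ := by ring

lemma arB2 (e m N b L g : ℝ) (he : 0 < e) (hm : 0 < m) (hN : 0 < N) (hb : 0 < b) (hg : 0 ≤ g)
    (heb : e ≤ 6 * m * b) (hLe : L * e ^ 4 = 2 ^ 17 * m ^ 6 * N ^ 4)
    (h : g ≤ 3 * (256 * (8 * N ^ 2 * L ^ 2 / (e * b ^ 4)) ^ 4) * b) :
    g * e ^ 51 ≤ 4 ^ 160 * m ^ 63 * N ^ 40 := by
  have e2 : 3 * (256 * (8 * N ^ 2 * L ^ 2 / (e * b ^ 4)) ^ 4) * b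
      = 3 * 2 ^ 20 * L ^ 8 * N ^ 8 / (e ^ 4 * b ^ 15) := by
    field_simp; ring
  rw [e2, le_div_iff₀ (by positivity)] at h
  have h1 : g * (e ^ 4 * b ^ 15) ≤ 3 * 2 ^ 20 * N ^ 8 * L ^ 8 := by
    calc _ = g * (e ^ 4 * b ^ 15) := by ring
      _ ≤ _ := h
      _ = _ := by ring
  have h2 : e ^ 15 ≤ (6 * m * b) ^ 15 := by gcongr
  calc g * e ^ 51 = g * e ^ 36 * e ^ 15 := by ring
    _ ≤ g * e ^ 36 * (6 * m * b) ^ 15 := by gcongr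
    _ = 6 ^ 15 * m ^ 15 * e ^ 32 * (g * (e ^ 4 * b ^ 15)) := by ring
    _ ≤ 6 ^ 15 * m ^ 15 * e ^ 32 * (3 * 2 ^ 20 * N ^ 8 * L ^ 8) := by gcongr
    _ = 6 ^ 15 * 3 * 2 ^ 20 * m ^ 15 * N ^ 8 * (L * e ^ 4) ^ 8 := by ring
    _ = (6 ^ 15 * 3 * 2 ^ 20 * (2 ^ 17) ^ 8) * (m ^ 63 * N ^ 40) := by rw [hLe]; ring
    _ ≤ 4 ^ 160 * (m ^ 63 * N ^ 40) := by gcongr; norm_num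
    _ = _ := by ring

lemma arM (x p e N b L w z : ℝ) (hb : 0 < b) (he : 0 < e) (hN : 0 < N) (hx : 0 ≤ x)
    (hw0 : 0 ≤ w) (hz0 : 0 ≤ z)
    (hp : b * e / (8 * N ^ 2) ≤ p) (h : x * p ≤ w * z) (hw : w * b ≤ L) (hz : z * b ≤ L) :
    x ≤ 8 * N ^ 2 * L ^ 2 / (e * b ^ 4) * b := by
  have h1 : x * (b * e / (8 * N ^ 2)) ≤ w * z := le_trans (by gcongr) h
  have h2 : (w * b) * (z * b) ≤ L * L := by gcongr; exact le_trans (by positivity) hw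
  have e2 : 8 * N ^ 2 * L ^ 2 / (e * b ^ 4) * b = 8 * N ^ 2 * L ^ 2 / (e * b ^ 3) := by
    field_simp
  rw [e2, le_div_iff₀ (by positivity)]
  have e3 : x * (e * b ^ 3) = (x * (b * e / (8 * N ^ 2))) * (8 * N ^ 2 * b ^ 2) := by
    field_simp
  rw [e3]
  calc _ ≤ (w * z) * (8 * N ^ 2 * b ^ 2) := by gcongr
    _ = (w * b) * (z * b) * (8 * N ^ 2) := by ring
    _ ≤ L * L * (8 * N ^ 2) := by gcongr
    _ = _ := by ring

lemma core [Fintype F] (W1 W2 B A1 : Finset F) (r : F → F → Prop) (d : F)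
    (hd : d ≠ 0) (hr : ∀ w ∈ W1, ∀ v ∈ B, r w v → w - d * v ∈ W2)
    (hr' : ∀ w ∈ W1, ∀ v ∈ B, r w v → w / v ∈ A1)
    (hB0 : ∀ v ∈ B, v ≠ 0) (hW0 : ∀ w ∈ W1, w ≠ 0) (e m N : ℝ)
    (he : 0 < e) (hm : 0 < m) (hN : 0 < N) (hW1 : (W1.card : ℝ) ≤ m) (hW2 : (W2.card : ℝ) ≤ m)
    (hB : (B.card : ℝ) ≤ N) (hA1 : (A1.card : ℝ) ≤ N)
    (hG : e ≤ ((∑ w ∈ W1, (B.filter (fun v => r w v)).card : ℕ) : ℝ))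
    (hbig : 1 < e / (8 * N)) :
    ∃ D ⊆ A1, e / (8 * N) ≤ D.card ∧
      (e ^ 83 ≤ 4 ^ 160 * m ^ 103 * N ^ 62 ∨ e ^ 78 ≤ 4 ^ 160 * m ^ 95 * N ^ 60 ∨
       e ^ 53 ≤ 4 ^ 160 * m ^ 65 * N ^ 40 ∨
       ∃ G : Subfield F, (∀ a ∈ D, a / d ∈ G) ∧
        (Nat.card G : ℝ) * e ^ 51 ≤ 4 ^ 160 * m ^ 63 * N ^ 40) := by
  obtain ⟨B', hB', W', hW', h1, h2, h3, h4⟩ := add_bsg W1 W2 B r d hd hr e m N he hm hN hW1 hW2 hB hG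
  have hbp : (0 : ℝ) < B'.card := lt_of_lt_of_le (by positivity) h1
  have hBne : B'.Nonempty := Finset.card_pos.1 (by exact_mod_cast hbp)
  obtain ⟨v0, hv0, D, hDA, hDc, hDW, hDY⟩ := extract_D W' B' A1 r e N hN
    (fun v hv => hB0 v (hB' hv)) hBne he hA1
    (fun w hw v hv h => hr' w (hW' hw) v (hB' hv) h) h4
  have hD0 : ∀ a ∈ D, a ≠ 0 := by
    rintro a ha rfl
    exact hW0 _ (hW' (hDW _ ha)) (zero_mul _)
  have hv00 : v0 ≠ 0 := hB0 v0 (hB' hv0)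
  have hD2 : 2 ≤ D.card := by
    have : (1 : ℝ) < D.card := lt_of_lt_of_le hbig hDc
    exact_mod_cast this
  obtain ⟨L, hL⟩ : ∃ L : ℝ, L = 2 ^ 17 * m ^ 6 * N ^ 4 / e ^ 4 := ⟨_, rfl⟩
  rw [← hL] at h2 h3
  have hLp : 0 < L := by rw [hL]; positivity
  have hLe : L * e ^ 4 = 2 ^ 17 * m ^ 6 * N ^ 4 := by rw [hL]; field_simp
  have hM : ∀ a ∈ D, ((d • B' - a • B').card : ℝ) ≤
      8 * N ^ 2 * L ^ 2 / (e * (B'.card : ℝ) ^ 4) * B'.card := fun a ha =>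
    arM _ _ e N B'.card L _ _ hbp he hN (by positivity) (by positivity) (by positivity) (hDY a ha)
      (ruzsa_D W' B' a d (hD0 a ha) hd) h3 h2
  have hM0 : ((B' - B').card : ℝ) ≤ L / (B'.card : ℝ) ^ 2 * B'.card := by
    have : L / (B'.card : ℝ) ^ 2 * B'.card = L / B'.card := by field_simp
    rw [this, le_div_iff₀ hbp]; exact h2
  have heb : e ≤ 6 * m * B'.card := by
    rw [div_le_iff₀ (by positivity)] at h1
    linarith
  refine ⟨D, hDA, hDc, ?_⟩
  have hDlow : (e / (8 * N) * (B'.card : ℝ) ^ 2 / L) ^ 2 ≤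
      ((D.card : ℝ) * B'.card / (W' - d • B').card) ^ 2 := by
    have hne : (0 : ℝ) < (W' - d • B').card := by
      obtain ⟨a, ha⟩ := Finset.card_pos.1 (by omega : 0 < D.card)
      have : (W' - d • B').Nonempty := ⟨_, Finset.sub_mem_sub (hDW a ha)
        (Finset.smul_mem_smul_finset hv0)⟩
      exact_mod_cast this.card_pos
    have : e / (8 * N) * (B'.card : ℝ) ^ 2 / L ≤ (D.card : ℝ) * B'.card / (W' - d • B').card := by
      rw [div_le_div_iff₀ hLp hne]
      calc e / (8 * N) * (B'.card : ℝ) ^ 2 * (W' - d • B').card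
          = (e / (8 * N)) * B'.card * ((W' - d • B').card * B'.card) := by ring
        _ ≤ D.card * B'.card * L := by gcongr
    gcongr
  rcases pivot D B' W' d v0 _ _ hd hv00 hBne hD2 hDW hD0 hM hM0 with ⟨G, hG1, hG2⟩ | h | h
  · right; right
    rcases subfield_energy B' G _ hBne hG2 with h | h
    · left
      exact arB1 e m N _ L he hm hN hbp heb hLe h
    · right
      exact ⟨G, hG1, arB2 e m N _ L _ he hm hN hbp (by positivity) heb hLe h⟩
  · right; left
    exact arA5 e m N _ L he hm hN hbp hLp heb hLe (hDlow.trans h)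
  · left
    exact arA3 e m N _ L he hm hN hbp hLp heb hLe (hDlow.trans h)

def Pset (A : Finset F) (x y : F) (S : Finset F) : Finset (F × F) :=
  (A ×ˢ A).filter (fun p => p.2 ≠ y ∧ (p.1 - x) / (p.2 - y) ∈ S)

lemma P_count (A : Finset F) (L : Finset (F × F)) (k : ℕ)
    (hk : ∀ l ∈ L, k ≤ (A.filter (fun y => l.1 * y + l.2 ∈ A)).card) (x y : F) (S : Finset F)
    (hS : ∀ s ∈ S, (s, x - s * y) ∈ L) :
    (S.card : ℝ) * ((k : ℝ) - 1) ≤ (Pset A x y S).card := by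
  apply fiber_count S (Pset A x y S) (fun p => (p.1 - x) / (p.2 - y))
  intro s hs
  have h1 := hk _ (hS s hs)
  simp only at h1
  have h2 : ((A.filter (fun y' => s * y' + (x - s * y) ∈ A)).erase y).card ≤
      ((Pset A x y S).filter (fun p => (p.1 - x) / (p.2 - y) = s)).card := by
    apply Finset.card_le_card_of_injOn (fun y' => (s * y' + (x - s * y), y'))
    · intro y' hy'
      simp only [Finset.coe_erase, Finset.coe_filter, Set.mem_sdiff, Set.mem_ofPred_eq,
        Set.mem_singleton_iff] at hy'
      obtain ⟨⟨hA, hl⟩, hne⟩ := hy'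
      have hsl : (s * y' + (x - s * y) - x) / (y' - y) = s := by
        rw [div_eq_iff (sub_ne_zero.2 hne)]; ring
      simp only [Finset.coe_filter, Pset, Finset.mem_filter, Finset.mem_product, Set.mem_ofPred_eq]
      refine ⟨⟨⟨hl, hA⟩, hne, ?_⟩, hsl⟩
      rw [hsl]; exact hs
    · intro a _ b _ hab
      exact (Prod.mk.inj hab).2
  have h3 := Finset.pred_card_le_card_erase (s := A.filter (fun y' => s * y' + (x - s * y) ∈ A)) (a := y)
  have h4 : k ≤ ((Pset A x y S).filter (fun p => (p.1 - x) / (p.2 - y) = s)).card + 1 := by omega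
  have h5 : (k : ℝ) ≤ (((Pset A x y S).filter (fun p => (p.1 - x) / (p.2 - y) = s)).card : ℝ) + 1 := by
    exact_mod_cast h4
  linarith

lemma Pset_card_le (A : Finset F) (x y : F) (S : Finset F) :
    ((Pset A x y S).card : ℝ) ≤ (A.card : ℝ) ^ 2 := by
  have : (Pset A x y S).card ≤ (A ×ˢ A).card := Finset.card_filter_le _ _
  rw [Finset.card_product] at this
  rw [pow_two]
  exact_mod_cast this

def Rset [Fintype F] (L : Finset (F × F)) (p : F × F) : Finset F :=
  Finset.univ.filter (fun s => (s, p.1 - s * p.2) ∈ L)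

lemma R_sum [Fintype F] (A : Finset F) (L : Finset (F × F)) (k : ℕ)
    (hk : ∀ l ∈ L, k ≤ (A.filter (fun y => l.1 * y + l.2 ∈ A)).card) :
    (L.card : ℝ) * k ≤ ∑ p ∈ A ×ˢ A, ((Rset L p).card : ℝ) := by
  have h := fiber_count L ((A ×ˢ A).sigma (fun p => Rset L p))
    (fun x => (x.2, x.1.1 - x.2 * x.1.2)) (k : ℝ) ?_
  · rw [Finset.card_sigma] at h
    exact_mod_cast h
  rintro ⟨s, t⟩ hl
  have h1 := hk _ hl
  refine le_trans (Nat.cast_le.2 h1) (Nat.cast_le.2 ?_)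
  apply Finset.card_le_card_of_injOn (fun y => ⟨(s * y + t, y), s⟩)
  · intro y hy
    simp only [Finset.coe_filter, Set.mem_ofPred_eq, Finset.mem_sigma, Finset.mem_product, Rset,
      Finset.mem_filter, Finset.mem_univ, true_and] at hy ⊢
    have : s * y + t - s * y = t := by ring
    rw [this]
    exact ⟨⟨⟨hy.2, hy.1⟩, hl⟩, rfl⟩
  · intro a _ b _ hab
    have := congrArg (fun z : (_ : F × F) × F => z.1.2) hab
    exact this

lemma cs_inter {ι α : Type*} (S : Finset ι) (U : Finset α) (P : ι → Finset α) (hP : ∀ i ∈ S, P i ⊆ U) :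
    (∑ i ∈ S, ((P i).card : ℝ)) ^ 2 ≤ U.card * ∑ i ∈ S, ∑ j ∈ S, ((P i ∩ P j).card : ℝ) := by
  have e1 : ∀ i ∈ S, ((P i).card : ℝ) = ∑ u ∈ U, (if u ∈ P i then (1 : ℝ) else 0) := by
    intro i hi
    rw [← Finset.sum_filter, Finset.sum_const, nsmul_eq_mul, mul_one, Finset.filter_mem_eq_inter,
      Finset.inter_eq_right.2 (hP i hi)]
  have e2 : ∀ i ∈ S, ∀ j ∈ S, ((P i ∩ P j).card : ℝ) =
      ∑ u ∈ U, (if u ∈ P i then (1 : ℝ) else 0) * (if u ∈ P j then (1 : ℝ) else 0) := by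
    intro i hi j _
    have : ∀ u, (if u ∈ P i then (1 : ℝ) else 0) * (if u ∈ P j then (1 : ℝ) else 0) =
      if u ∈ P i ∩ P j then 1 else 0 := by
      intro u
      by_cases h1 : u ∈ P i <;> by_cases h2 : u ∈ P j <;> simp [h1, h2]
    simp_rw [this]
    rw [← Finset.sum_filter, Finset.sum_const, nsmul_eq_mul, mul_one, Finset.filter_mem_eq_inter,
      Finset.inter_eq_right.2 (Finset.inter_subset_left.trans (hP i hi))]
  rw [Finset.sum_congr rfl e1, Finset.sum_congr rfl (fun i hi => Finset.sum_congr rfl (e2 i hi))]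
  rw [Finset.sum_comm]
  refine sq_sum_le_card_mul_sum_sq.trans (le_of_eq ?_)
  congr 1
  have : ∀ i ∈ S, ∑ j ∈ S, ∑ u ∈ U, (if u ∈ P i then (1 : ℝ) else 0) * (if u ∈ P j then (1 : ℝ) else 0) =
     ∑ u ∈ U, (if u ∈ P i then (1 : ℝ) else 0) * ∑ j ∈ S, (if u ∈ P j then (1 : ℝ) else 0) := by
    intro i _
    rw [Finset.sum_comm]
    simp_rw [Finset.mul_sum]
  rw [Finset.sum_congr rfl this, Finset.sum_comm]
  apply Finset.sum_congr rfl
  intro u _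
  rw [← Finset.sum_mul, pow_two]

lemma cs_pair {ι α : Type*} (S : Finset ι) (U : Finset α) (P : ι → Finset α) (hP : ∀ i ∈ S, P i ⊆ U)
    (c V : ℝ) (hV : 0 < V) (hU : (U.card : ℝ) ≤ V) (hc : 0 < c) (hPc : ∀ i ∈ S, c ≤ ((P i).card : ℝ))
    (hS : V < S.card * (c ^ 2 / (2 * V))) :
    ∃ i ∈ S, ∃ j ∈ S, i ≠ j ∧ c ^ 2 / (2 * V) ≤ ((P i ∩ P j).card : ℝ) := by
  by_contra hcon
  push Not at hcon
  have h1 := cs_inter S U P hP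
  have h2 : (S.card : ℝ) * c ≤ ∑ i ∈ S, ((P i).card : ℝ) := by
    calc (S.card : ℝ) * c = ∑ i ∈ S, c := by simp
      _ ≤ _ := Finset.sum_le_sum hPc
  have h3 : ∑ i ∈ S, ∑ j ∈ S, ((P i ∩ P j).card : ℝ) ≤
      S.card * (V + S.card * (c ^ 2 / (2 * V))) := by
    calc _ ≤ ∑ i ∈ S, (V + S.card * (c ^ 2 / (2 * V))) := by
          apply Finset.sum_le_sum
          intro i hi
          rw [← Finset.add_sum_erase S _ hi]
          apply add_le_add
          · refine le_trans ?_ hU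
            exact_mod_cast Finset.card_le_card (Finset.inter_subset_left.trans (hP i hi))
          · calc _ ≤ ∑ j ∈ S.erase i, c ^ 2 / (2 * V) := by
                  apply Finset.sum_le_sum
                  intro j hj
                  exact (hcon i hi j (Finset.mem_of_mem_erase hj) (Finset.ne_of_mem_erase hj).symm).le
              _ = ((S.erase i).card : ℝ) * (c ^ 2 / (2 * V)) := by simp
              _ ≤ _ := by
                gcongr
                exact Finset.erase_subset _ _
      _ = _ := by rw [Finset.sum_const, nsmul_eq_mul]
  have h4 : ((S.card : ℝ) * c) ^ 2 ≤ V * (S.card * (V + S.card * (c ^ 2 / (2 * V)))) := by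
    calc _ ≤ (∑ i ∈ S, ((P i).card : ℝ)) ^ 2 := by gcongr
      _ ≤ _ := h1
      _ ≤ _ := by gcongr
  have hSp : (0 : ℝ) < S.card := by
    by_contra h
    have : (S.card : ℝ) = 0 := le_antisymm (not_lt.1 h) (by positivity)
    rw [this] at hS
    linarith
  generalize (S.card : ℝ) = s at *
  have e1 : V * (s * (V + s * (c ^ 2 / (2 * V)))) = s * V ^ 2 + s ^ 2 * c ^ 2 / 2 := by
    field_simp
  rw [e1] at h4
  have e2 : s * (c ^ 2 / (2 * V)) = s * c ^ 2 / (2 * V) := by ring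
  rw [e2, lt_div_iff₀ (by positivity)] at hS
  have := mul_lt_mul_of_pos_left hS hSp
  nlinarith

lemma R_card_le [Fintype F] (A : Finset F) (L : Finset (F × F)) (k : ℕ) (hk2 : 2 ≤ k)
    (hk : ∀ l ∈ L, k ≤ (A.filter (fun y => l.1 * y + l.2 ∈ A)).card) (p : F × F) :
    ((Rset L p).card : ℝ) * k ≤ 2 * (A.card : ℝ) ^ 2 := by
  have h1 := P_count A L k hk p.1 p.2 (Rset L p) (fun s hs => (Finset.mem_filter.1 hs).2)
  have h2 := h1.trans (Pset_card_le A _ _ _)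
  have h3 : (2 : ℝ) ≤ k := by exact_mod_cast hk2
  have h4 : (0 : ℝ) ≤ (Rset L p).card := by positivity
  nlinarith

lemma T_bound [Fintype F] (A : Finset F) (L : Finset (F × F)) (k : ℕ) (hk2 : 2 ≤ k)
    (hk : ∀ l ∈ L, k ≤ (A.filter (fun y => l.1 * y + l.2 ∈ A)).card) :
    (L.card : ℝ) * (k : ℝ) ^ 2 ≤ 2 * (A.card : ℝ) ^ 4 := by
  have h1 := R_sum A L k hk
  have h2 : ∑ p ∈ A ×ˢ A, ((Rset L p).card : ℝ) * k ≤ ∑ p ∈ A ×ˢ A, 2 * (A.card : ℝ) ^ 2 :=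
    Finset.sum_le_sum (fun p _ => R_card_le A L k hk2 hk p)
  rw [← Finset.sum_mul, Finset.sum_const, nsmul_eq_mul, Finset.card_product] at h2
  push_cast at h2
  have : (0 : ℝ) ≤ k := by positivity
  nlinarith

lemma row [Fintype F] (A : Finset F) (hA : A.Nonempty) (L : Finset (F × F)) (k : ℕ) (hk2 : 2 ≤ k)
    (hk : ∀ l ∈ L, k ≤ (A.filter (fun y => l.1 * y + l.2 ∈ A)).card) (m : ℕ)
    (hm : m = ⌈(L.card : ℝ) * k / (2 * (A.card : ℝ) ^ 2)⌉₊) :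
    ∃ y0 ∈ A, (L.card : ℝ) * (k : ℝ) ^ 2 / (4 * (A.card : ℝ) ^ 3) ≤
      ((A.filter (fun x => m ≤ (Rset L (x, y0)).card)).card : ℝ) := by
  have hAp : (0 : ℝ) < A.card := by exact_mod_cast hA.card_pos
  have hkp : (0 : ℝ) < k := by exact_mod_cast (by omega : 0 < k)
  have h1 := R_sum A L k hk
  have h2 := Finset.sum_filter_add_sum_filter_not (A ×ˢ A) (fun p => m ≤ (Rset L p).card)
    (fun p => ((Rset L p).card : ℝ))
  have h3 : ∑ p ∈ (A ×ˢ A).filter (fun p => ¬ m ≤ (Rset L p).card), ((Rset L p).card : ℝ) ≤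
      (L.card : ℝ) * k / 2 := by
    calc _ ≤ ∑ p ∈ (A ×ˢ A).filter (fun p => ¬ m ≤ (Rset L p).card),
          ((L.card : ℝ) * k / (2 * (A.card : ℝ) ^ 2)) := by
          apply Finset.sum_le_sum
          intro p hp
          have := (Finset.mem_filter.1 hp).2
          rw [hm, Nat.ceil_le] at this
          exact (not_le.1 this).le
      _ = (((A ×ˢ A).filter (fun p => ¬ m ≤ (Rset L p).card)).card : ℝ) *
          ((L.card : ℝ) * k / (2 * (A.card : ℝ) ^ 2)) := by rw [Finset.sum_const, nsmul_eq_mul]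
      _ ≤ (A.card : ℝ) ^ 2 * ((L.card : ℝ) * k / (2 * (A.card : ℝ) ^ 2)) := by
        gcongr
        rw [pow_two]
        exact_mod_cast (Finset.card_filter_le _ _).trans (le_of_eq (Finset.card_product A A))
      _ = _ := by field_simp
  have h4 : ∑ p ∈ (A ×ˢ A).filter (fun p => m ≤ (Rset L p).card), ((Rset L p).card : ℝ) ≤
      (((A ×ˢ A).filter (fun p => m ≤ (Rset L p).card)).card : ℝ) * (2 * (A.card : ℝ) ^ 2 / k) := by
    rw [← nsmul_eq_mul, ← Finset.sum_const]
    apply Finset.sum_le_sum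
    intro p _
    rw [le_div_iff₀ hkp]
    exact R_card_le A L k hk2 hk p
  have h5 : (L.card : ℝ) * k / 2 ≤ (((A ×ˢ A).filter (fun p => m ≤ (Rset L p).card)).card : ℝ) *
      (2 * (A.card : ℝ) ^ 2 / k) := by linarith
  have h6 : ((A ×ˢ A).filter (fun p => m ≤ (Rset L p).card)).card =
      ∑ y ∈ A, (A.filter (fun x => m ≤ (Rset L (x, y)).card)).card := by
    have e1 := card_filter_prod A A (fun x y => m ≤ (Rset L (x, y)).card)
    have e2 := double_count A A (fun x y => m ≤ (Rset L (x, y)).card)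
    rw [e2] at e1
    convert e1
  have h7 : ∑ y ∈ A, (L.card : ℝ) * (k : ℝ) ^ 2 / (4 * (A.card : ℝ) ^ 3) ≤
      ∑ y ∈ A, ((A.filter (fun x => m ≤ (Rset L (x, y)).card)).card : ℝ) := by
    have e3 : (((A ×ˢ A).filter (fun p => m ≤ (Rset L p).card)).card : ℝ) =
      ∑ y ∈ A, ((A.filter (fun x => m ≤ (Rset L (x, y)).card)).card : ℝ) := by exact_mod_cast h6
    rw [← e3, Finset.sum_const, nsmul_eq_mul]
    generalize (((A ×ˢ A).filter (fun p => m ≤ (Rset L p).card)).card : ℝ) = Q at h5 ⊢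
    generalize (A.card : ℝ) = n at *
    rw [← mul_div_assoc, le_div_iff₀ hkp] at h5
    have : n * ((L.card : ℝ) * (k : ℝ) ^ 2 / (4 * n ^ 3)) = (L.card : ℝ) * (k : ℝ) ^ 2 / (4 * n ^ 2) := by
      field_simp
    rw [this, div_le_iff₀ (by positivity)]
    nlinarith
  obtain ⟨y0, hy0, h8⟩ := Finset.exists_le_of_sum_le hA h7
  exact ⟨y0, hy0, h8⟩

lemma rich_core [Fintype F] (A : Finset F) (hA : A.Nonempty) (L : Finset (F × F)) (k : ℕ) (hk2 : 2 ≤ k)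
    (hk : ∀ l ∈ L, k ≤ (A.filter (fun y => l.1 * y + l.2 ∈ A)).card) (hL0 : ∀ l ∈ L, l.1 ≠ 0)
    (m : ℕ) (hm : m = ⌈(L.card : ℝ) * k / (2 * (A.card : ℝ) ^ 2)⌉₊) (hmp : 0 < m) (e : ℝ)
    (he : e = ((m : ℝ) * k / 2) ^ 2 / (2 * (A.card : ℝ) ^ 2))
    (hcond : (A.card : ℝ) ^ 2 < (L.card : ℝ) * (k : ℝ) ^ 2 / (4 * (A.card : ℝ) ^ 3) * e)
    (hbig : 1 < e / (8 * (A.card : ℝ))) :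
    ∃ x1 d : F, ∃ D ⊆ A.image (fun x => x - x1), d ≠ 0 ∧ e / (8 * (A.card : ℝ)) ≤ D.card ∧
      (e ^ 83 ≤ 4 ^ 160 * (m : ℝ) ^ 103 * (A.card : ℝ) ^ 62 ∨
       e ^ 78 ≤ 4 ^ 160 * (m : ℝ) ^ 95 * (A.card : ℝ) ^ 60 ∨
       e ^ 53 ≤ 4 ^ 160 * (m : ℝ) ^ 65 * (A.card : ℝ) ^ 40 ∨
       ∃ G : Subfield F, (∀ a ∈ D, a / d ∈ G) ∧
        (Nat.card G : ℝ) * e ^ 51 ≤ 4 ^ 160 * (m : ℝ) ^ 63 * (A.card : ℝ) ^ 40) := by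
  have hAp : (0 : ℝ) < A.card := by exact_mod_cast hA.card_pos
  have hkp : (0 : ℝ) < k := by exact_mod_cast (by omega : 0 < k)
  have hmp' : (0 : ℝ) < m := by exact_mod_cast hmp
  have hep : 0 < e := by rw [he]; positivity
  obtain ⟨y0, hy0, hrow⟩ := row A hA L k hk2 hk m hm
  let S := A.filter (fun x => m ≤ (Rset L (x, y0)).card)
  have hW : ∀ x, ∃ W : Finset F, x ∈ S → W ⊆ Rset L (x, y0) ∧ W.card = m := by
    intro x
    by_cases hx : x ∈ S
    · obtain ⟨W, h1, h2⟩ := Finset.exists_subset_card_eq (Finset.mem_filter.1 hx).2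
      exact ⟨W, fun _ => ⟨h1, h2⟩⟩
    · exact ⟨∅, fun h => absurd h hx⟩
  choose W hW using hW
  have hWL : ∀ x ∈ S, ∀ s ∈ W x, (s, x - s * y0) ∈ L := fun x hx s hs =>
    (Finset.mem_filter.1 ((hW x hx).1 hs)).2
  obtain ⟨x1, hx1, x2, hx2, hne, hinter⟩ := cs_pair S (A ×ˢ A) (fun x => Pset A x y0 (W x))
    (fun x _ => Finset.filter_subset _ _) ((m : ℝ) * k / 2) ((A.card : ℝ) ^ 2) (by positivity)
    (by rw [Finset.card_product, pow_two]; push_cast; exact le_rfl) (by positivity)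
    (by
      intro x hx
      have h1 := P_count A L k hk x y0 (W x) (hWL x hx)
      rw [(hW x hx).2] at h1
      refine le_trans ?_ h1
      have : (2 : ℝ) ≤ k := by exact_mod_cast hk2
      nlinarith)
    (by
      rw [← he]
      refine hcond.trans_le ?_
      gcongr)
  rw [← he] at hinter
  let B := (A.erase y0).image (fun y => 1 / (y - y0))
  let r : F → F → Prop := fun w v => (x1 + w / v, y0 + 1 / v) ∈ Pset A x1 y0 (W x1) ∩ Pset A x2 y0 (W x2)
  have hB0 : ∀ v ∈ B, v ≠ 0 := by
    intro v hv
    obtain ⟨y, hy, rfl⟩ := Finset.mem_image.1 hv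
    exact one_div_ne_zero (sub_ne_zero.2 (Finset.ne_of_mem_erase hy))
  have hd : x2 - x1 ≠ 0 := sub_ne_zero.2 hne.symm
  obtain ⟨D, hD1, hD2, hD3⟩ := core (W x1) (W x2) B (A.image (fun x => x - x1)) r (x2 - x1) hd
    (by
      intro w _ v hv h
      have hv0 := hB0 v hv
      simp only [r, Finset.mem_inter, Pset, Finset.mem_filter] at h
      have h1 := h.2.2.2
      have : (x1 + w / v - x2) / (y0 + 1 / v - y0) = w - (x2 - x1) * v := by
        rw [add_sub_cancel_left]
        field_simp
        ring
      rwa [this] at h1)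
    (by
      intro w _ v hv h
      simp only [r, Finset.mem_inter, Pset, Finset.mem_filter, Finset.mem_product] at h
      exact Finset.mem_image.2 ⟨_, h.1.1.1, by ring⟩)
    hB0 (fun w hw => hL0 _ (hWL x1 hx1 w hw)) e m A.card hep hmp' hAp
    (by rw [(hW x1 hx1).2]) (by rw [(hW x2 hx2).2])
    (by exact_mod_cast Finset.card_image_le.trans (Finset.card_le_card (Finset.erase_subset _ _)))
    (by exact_mod_cast Finset.card_image_le)
    (by
      refine hinter.trans (Nat.cast_le.2 ?_)
      rw [← card_filter_prod]
      apply Finset.card_le_card_of_injOn (fun p => ((p.1 - x1) / (p.2 - y0), 1 / (p.2 - y0)))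
      · rintro ⟨x, y⟩ hp
        have hp' := hp
        simp only [Finset.coe_inter, Set.mem_inter_iff, Finset.mem_coe, Pset, Finset.mem_filter,
          Finset.mem_product] at hp
        obtain ⟨⟨⟨hxA, hyA⟩, hyne, hw1⟩, -⟩ := hp
        have hyn : y - y0 ≠ 0 := sub_ne_zero.2 hyne
        simp only [Finset.coe_filter, Finset.mem_product, Set.mem_ofPred_eq]
        refine ⟨⟨hw1, Finset.mem_image.2 ⟨y, Finset.mem_erase.2 ⟨hyne, hyA⟩, rfl⟩⟩, ?_⟩
        have e1 : x1 + (x - x1) / (y - y0) / (1 / (y - y0)) = x := by field_simp; ring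
        have e2 : y0 + 1 / (1 / (y - y0)) = y := by field_simp; ring
        simp only [r]
        rw [e1, e2]
        simp only [Finset.coe_inter, Set.mem_inter_iff, Finset.mem_coe] at hp'
        exact Finset.mem_inter.2 hp'
      · rintro ⟨x, y⟩ hp ⟨x', y'⟩ hp' heq
        simp only [Finset.coe_inter, Set.mem_inter_iff, Finset.mem_coe, Pset, Finset.mem_filter] at hp hp'
        simp only [Prod.mk.injEq] at heq ⊢
        have hyn : y - y0 ≠ 0 := sub_ne_zero.2 hp.1.2.1
        have hyn' : y' - y0 ≠ 0 := sub_ne_zero.2 hp'.1.2.1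
        obtain ⟨h1, h2⟩ := heq
        have e1 : y = y' := by
          field_simp at h2
          linear_combination -h2
        subst e1
        field_simp at h1
        exact ⟨by linear_combination h1, rfl⟩)
    hbig
  exact ⟨x1, x2 - x1, D, hD1, hd, hD2, hD3⟩

lemma nA3 (m k N u e : ℝ) (hm : 0 < m) (hk : 0 < k) (hN : 0 < N) (hu : 0 < u)
    (h1 : u * N ^ 3 ≤ m * k ^ 2) (h2 : u * N ≤ k) (he : e = (m * k / 2) ^ 2 / (2 * N ^ 2))
    (h : e ^ 83 ≤ 4 ^ 160 * m ^ 103 * N ^ 62) : N * u ^ 103 ≤ 4 ^ 160 * 8 ^ 83 := by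
  have e1 : e = m ^ 2 * k ^ 2 / (8 * N ^ 2) := by rw [he]; field_simp; norm_num
  rw [e1, div_pow, div_le_iff₀ (by positivity)] at h
  have h3 : (u * N ^ 3) ^ 63 * (u * N) ^ 40 ≤ (m * k ^ 2) ^ 63 * k ^ 40 := by gcongr
  apply le_of_mul_le_mul_right _ (show 0 < N ^ 228 * m ^ 103 by positivity)
  calc N * u ^ 103 * (N ^ 228 * m ^ 103) = (u * N ^ 3) ^ 63 * (u * N) ^ 40 * m ^ 103 := by ring
    _ ≤ (m * k ^ 2) ^ 63 * k ^ 40 * m ^ 103 := by gcongr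
    _ = (m ^ 2 * k ^ 2) ^ 83 := by ring
    _ ≤ _ := h
    _ = _ := by ring

lemma nA5 (m k N u e : ℝ) (hm : 0 < m) (hk : 0 < k) (hN : 0 < N) (hu : 0 < u)
    (h1 : u * N ^ 3 ≤ m * k ^ 2) (h2 : u * N ≤ k) (he : e = (m * k / 2) ^ 2 / (2 * N ^ 2))
    (h : e ^ 78 ≤ 4 ^ 160 * m ^ 95 * N ^ 60) : N * u ^ 95 ≤ 4 ^ 160 * 8 ^ 78 := by
  have e1 : e = m ^ 2 * k ^ 2 / (8 * N ^ 2) := by rw [he]; field_simp; norm_num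
  rw [e1, div_pow, div_le_iff₀ (by positivity)] at h
  have h3 : (u * N ^ 3) ^ 61 * (u * N) ^ 34 ≤ (m * k ^ 2) ^ 61 * k ^ 34 := by gcongr
  apply le_of_mul_le_mul_right _ (show 0 < N ^ 216 * m ^ 95 by positivity)
  calc N * u ^ 95 * (N ^ 216 * m ^ 95) = (u * N ^ 3) ^ 61 * (u * N) ^ 34 * m ^ 95 := by ring
    _ ≤ (m * k ^ 2) ^ 61 * k ^ 34 * m ^ 95 := by gcongr
    _ = (m ^ 2 * k ^ 2) ^ 78 := by ring
    _ ≤ _ := h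
    _ = _ := by ring

lemma nB1 (m k N u e : ℝ) (hm : 0 < m) (hk : 0 < k) (hN : 0 < N) (hu : 0 < u)
    (h1 : u * N ^ 3 ≤ m * k ^ 2) (h2 : u * N ≤ k) (he : e = (m * k / 2) ^ 2 / (2 * N ^ 2))
    (h : e ^ 53 ≤ 4 ^ 160 * m ^ 65 * N ^ 40) : N * u ^ 65 ≤ 4 ^ 160 * 8 ^ 53 := by
  have e1 : e = m ^ 2 * k ^ 2 / (8 * N ^ 2) := by rw [he]; field_simp; norm_num
  rw [e1, div_pow, div_le_iff₀ (by positivity)] at h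
  have h3 : (u * N ^ 3) ^ 41 * (u * N) ^ 24 ≤ (m * k ^ 2) ^ 41 * k ^ 24 := by gcongr
  apply le_of_mul_le_mul_right _ (show 0 < N ^ 146 * m ^ 65 by positivity)
  calc N * u ^ 65 * (N ^ 146 * m ^ 65) = (u * N ^ 3) ^ 41 * (u * N) ^ 24 * m ^ 65 := by ring
    _ ≤ (m * k ^ 2) ^ 41 * k ^ 24 * m ^ 65 := by gcongr
    _ = (m ^ 2 * k ^ 2) ^ 53 := by ring
    _ ≤ _ := h
    _ = _ := by ring

lemma nB2 (m k N u e g : ℝ) (hm : 0 < m) (hk : 0 < k) (hN : 0 < N) (hu : 0 < u) (hg : 0 ≤ g)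
    (h1 : u * N ^ 3 ≤ m * k ^ 2) (h2 : u * N ≤ k) (he : e = (m * k / 2) ^ 2 / (2 * N ^ 2))
    (h : g * e ^ 51 ≤ 4 ^ 160 * m ^ 63 * N ^ 40) : g * u ^ 63 ≤ 4 ^ 160 * 8 ^ 51 * N := by
  have e1 : e = m ^ 2 * k ^ 2 / (8 * N ^ 2) := by rw [he]; field_simp; norm_num
  rw [e1, div_pow, ← mul_div_assoc, div_le_iff₀ (by positivity)] at h
  have h3 : (u * N ^ 3) ^ 39 * (u * N) ^ 24 ≤ (m * k ^ 2) ^ 39 * k ^ 24 := by gcongr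
  apply le_of_mul_le_mul_right _ (show 0 < N ^ 141 * m ^ 63 by positivity)
  calc g * u ^ 63 * (N ^ 141 * m ^ 63) = g * ((u * N ^ 3) ^ 39 * (u * N) ^ 24) * m ^ 63 := by ring
    _ ≤ g * ((m * k ^ 2) ^ 39 * k ^ 24) * m ^ 63 := by gcongr
    _ = g * (m ^ 2 * k ^ 2) ^ 51 := by ring
    _ ≤ _ := h
    _ = _ := by ring

lemma contra_pow (N Δ c K : ℝ) (j : ℕ) (hj : j ≤ 104) (hΔ0 : 0 < Δ) (hΔ1 : Δ ≤ 1) (hN : 0 < N)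
    (hΔN : 1 ≤ N * Δ ^ 104) (hc : 0 < c) (h : N * (c * Δ) ^ j ≤ K) : c ^ j ≤ K := by
  have h1 : Δ ^ 104 ≤ Δ ^ j := pow_le_pow_of_le_one hΔ0.le hΔ1 hj
  have h2 : 1 ≤ N * Δ ^ j := hΔN.trans (by gcongr)
  calc c ^ j = c ^ j * 1 := by ring
    _ ≤ c ^ j * (N * Δ ^ j) := by gcongr
    _ = N * (c * Δ) ^ j := by ring
    _ ≤ K := h

lemma D_in (A D : Finset F) (x1 d : F) (hd : d ≠ 0) (hD : D ⊆ A.image (fun x => x - x1))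
    (G : Subfield F) (hG : ∀ a ∈ D, a / d ∈ G) :
    D.card ≤ (A.filter fun x => ∃ g ∈ G, x = d * g + x1).card := by
  apply Finset.card_le_card_of_injOn (fun a => a + x1)
  · intro a ha
    obtain ⟨x, hx, rfl⟩ := Finset.mem_image.1 (hD ha)
    simp only [Finset.coe_filter, Set.mem_ofPred_eq, sub_add_cancel]
    refine ⟨hx, (x - x1) / d, hG _ ha, ?_⟩
    field_simp
    ring
  · intro a _ b _ h
    exact add_right_cancel h

lemma rich_bound [Fintype F] (C : ℝ) (hC : 0 < C) (A : Finset F) (hA : A.Nonempty)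
    (hsub : subfieldCond A C ((A.card : ℝ) ^ ((51:ℝ)/52))) (Δ : ℝ) (hΔ0 : 0 < Δ) (hΔ1 : Δ ≤ 1)
    (hΔN : 1 ≤ (A.card : ℝ) * Δ ^ 104) (hΔq : (A.card : ℝ) ≤ Fintype.card F * Δ ^ 95)
    (h51 : (A.card : ℝ) ^ ((51:ℝ)/52) ≤ A.card * Δ ^ 2)
    (L : Finset (F × F)) (k : ℕ) (hk2 : 2 ≤ k)
    (hk : ∀ l ∈ L, k ≤ (A.filter (fun y => l.1 * y + l.2 ∈ A)).card) (hL0 : ∀ l ∈ L, l.1 ≠ 0) :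
    (L.card : ℝ) * (k : ℝ) ^ 3 ≤ 2 * (256 * (1 + C)) * (A.card : ℝ) ^ 5 * Δ := by
  by_contra hcon
  push Not at hcon
  obtain ⟨c, hc⟩ : ∃ c : ℝ, c = 256 * (1 + C) := ⟨_, rfl⟩
  rw [← hc] at hcon
  have hc256 : 256 ≤ c := by rw [hc]; linarith
  have hcC : 256 * C ≤ c := by rw [hc]; linarith
  have hcp : 0 < c := by linarith
  have hAp : (0 : ℝ) < A.card := by exact_mod_cast hA.card_pos
  have hkp : (0 : ℝ) < k := by exact_mod_cast (by omega : 0 < k)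
  have hTp : (0 : ℝ) < L.card := by
    by_contra h
    have : (L.card : ℝ) = 0 := le_antisymm (not_lt.1 h) (by positivity)
    rw [this, zero_mul] at hcon
    have : 0 < 2 * c * (A.card : ℝ) ^ 5 * Δ := by positivity
    linarith
  have hkN : (k : ℝ) ≤ A.card := by
    obtain ⟨l, hl⟩ := Finset.card_pos.1 (by exact_mod_cast hTp : 0 < L.card)
    exact_mod_cast (hk l hl).trans (Finset.card_filter_le _ _)
  have hTb := T_bound A L k hk2 hk
  obtain ⟨m, hm⟩ : ∃ m : ℕ, m = ⌈(L.card : ℝ) * k / (2 * (A.card : ℝ) ^ 2)⌉₊ := ⟨_, rfl⟩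
  have hmX : (L.card : ℝ) * k / (2 * (A.card : ℝ) ^ 2) ≤ m := by rw [hm]; exact Nat.le_ceil _
  have hmp : 0 < m := by rw [hm]; exact Nat.ceil_pos.2 (by positivity)
  have hmp' : (0 : ℝ) < m := by exact_mod_cast hmp
  obtain ⟨e, he⟩ : ∃ e : ℝ, e = ((m : ℝ) * k / 2) ^ 2 / (2 * (A.card : ℝ) ^ 2) := ⟨_, rfl⟩
  obtain ⟨u, hu⟩ : ∃ u : ℝ, u = c * Δ := ⟨_, rfl⟩
  have hup : 0 < u := by rw [hu]; positivity
  have hcon' : 2 * u * (A.card : ℝ) ^ 5 < (L.card : ℝ) * (k : ℝ) ^ 3 := by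
    rw [hu]; linarith
  have hmk : u * (A.card : ℝ) ^ 3 ≤ m * (k : ℝ) ^ 2 := by
    rw [div_le_iff₀ (by positivity)] at hmX
    apply le_of_mul_le_mul_right _ (show (0:ℝ) < 2 * (A.card : ℝ) ^ 2 by positivity)
    calc _ = 2 * u * (A.card : ℝ) ^ 5 := by ring
      _ ≤ (L.card : ℝ) * (k : ℝ) ^ 3 := hcon'.le
      _ = (L.card : ℝ) * k * (k : ℝ) ^ 2 := by ring
      _ ≤ (m * (2 * (A.card : ℝ) ^ 2)) * (k : ℝ) ^ 2 := by gcongr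
      _ = _ := by ring
  have huk : u * A.card ≤ k := by
    apply le_of_mul_le_mul_right _ (show (0:ℝ) < 2 * (A.card : ℝ) ^ 4 by positivity)
    calc _ = 2 * u * (A.card : ℝ) ^ 5 := by ring
      _ ≤ (L.card : ℝ) * (k : ℝ) ^ 3 := hcon'.le
      _ = (L.card : ℝ) * (k : ℝ) ^ 2 * k := by ring
      _ ≤ (2 * (A.card : ℝ) ^ 4) * k := by gcongr
      _ = _ := by ring
  have hmk2 : u ^ 2 * (A.card : ℝ) ^ 4 ≤ (m : ℝ) ^ 2 * (k : ℝ) ^ 2 := by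
    apply le_of_mul_le_mul_right _ (show (0:ℝ) < (A.card : ℝ) ^ 2 by positivity)
    calc _ = (u * (A.card : ℝ) ^ 3) ^ 2 := by ring
      _ ≤ (m * (k : ℝ) ^ 2) ^ 2 := by gcongr
      _ = (m : ℝ) ^ 2 * (k : ℝ) ^ 2 * (k : ℝ) ^ 2 := by ring
      _ ≤ _ := by gcongr
  have he1 : e = (m : ℝ) ^ 2 * (k : ℝ) ^ 2 / (8 * (A.card : ℝ) ^ 2) := by
    rw [he]; field_simp; norm_num
  have he2 : u ^ 2 * A.card / 64 ≤ e / (8 * A.card) := by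
    rw [he1, div_div, div_le_div_iff₀ (by positivity) (by positivity)]
    calc _ = 64 * (u ^ 2 * (A.card : ℝ) ^ 4) := by ring
      _ ≤ 64 * ((m : ℝ) ^ 2 * (k : ℝ) ^ 2) := by gcongr
      _ = _ := by ring
  have hpw : ∀ j ≤ 104, c ^ j ≤ A.card * u ^ j := by
    intro j hj
    apply contra_pow (A.card : ℝ) Δ c _ j hj hΔ0 hΔ1 hAp hΔN hcp
    rw [hu]
  have hTN : 2 * u * (A.card : ℝ) ^ 2 ≤ L.card := by
    apply le_of_mul_le_mul_right _ (show (0:ℝ) < (A.card : ℝ) ^ 3 by positivity)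
    calc _ = 2 * u * (A.card : ℝ) ^ 5 := by ring
      _ ≤ (L.card : ℝ) * (k : ℝ) ^ 3 := hcon'.le
      _ ≤ _ := by gcongr
  have hcond : (A.card : ℝ) ^ 2 < (L.card : ℝ) * (k : ℝ) ^ 2 / (4 * (A.card : ℝ) ^ 3) * e := by
    have e3 : (L.card : ℝ) * (k : ℝ) ^ 2 / (4 * (A.card : ℝ) ^ 3) * e =
      (L.card : ℝ) * (m * (k : ℝ) ^ 2) ^ 2 / (32 * (A.card : ℝ) ^ 5) := by
      rw [he1]; field_simp; norm_num
    rw [e3, lt_div_iff₀ (by positivity)]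
    calc (A.card : ℝ) ^ 2 * (32 * (A.card : ℝ) ^ 5) = 32 * (A.card : ℝ) ^ 7 := by ring
      _ < 2 * (c ^ 3) * (A.card : ℝ) ^ 7 := by
        gcongr
        calc (32 : ℝ) < 2 * 256 ^ 3 := by norm_num
          _ ≤ 2 * c ^ 3 := by gcongr
      _ ≤ 2 * (A.card * u ^ 3) * (A.card : ℝ) ^ 7 := by
        gcongr
        exact hpw 3 (by norm_num)
      _ = (2 * u * (A.card : ℝ) ^ 2) * (u * (A.card : ℝ) ^ 3) ^ 2 := by ring
      _ ≤ _ := by gcongr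
  have hbig : 1 < e / (8 * (A.card : ℝ)) := by
    refine lt_of_lt_of_le ?_ he2
    have := hpw 2 (by norm_num)
    have : (256 : ℝ) ^ 2 ≤ c ^ 2 := by gcongr
    linarith
  obtain ⟨x1, d, D, hD1, hd, hD2, hD3⟩ := rich_core A hA L k hk2 hk hL0 m hm hmp e he hcond hbig
  have hcj : ∀ j : ℕ, (256 : ℝ) ^ j ≤ c ^ j := fun j => by gcongr
  rcases hD3 with h | h | h | ⟨G, hG1, hG2⟩
  · have h1 := nA3 m k A.card u e hmp' hkp hAp hup hmk huk he h
    have h2 := (hcj 103).trans ((hpw 103 (by norm_num)).trans h1)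
    norm_num at h2
  · have h1 := nA5 m k A.card u e hmp' hkp hAp hup hmk huk he h
    have h2 := (hcj 95).trans ((hpw 95 (by norm_num)).trans h1)
    norm_num at h2
  · have h1 := nB1 m k A.card u e hmp' hkp hAp hup hmk huk he h
    have h2 := (hcj 65).trans ((hpw 65 (by norm_num)).trans h1)
    norm_num at h2
  · have hgp : (0 : ℝ) < Nat.card G := by exact_mod_cast Nat.card_pos
    have h1 := nB2 m k A.card u e _ hmp' hkp hAp hup hgp.le hmk huk he hG2
    by_cases hGt : G = ⊤
    · have hcard : (Nat.card G : ℝ) = Fintype.card F := by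
        subst hGt
        rw [← Nat.card_eq_fintype_card]
        exact_mod_cast Nat.card_congr (Subfield.topEquiv (K := F)).toEquiv
      rw [hcard] at h1 hgp
      have h2 : c ^ 63 * (Fintype.card F * Δ ^ 63) ≤ (4 ^ 160 * 8 ^ 51) * (Fintype.card F * Δ ^ 63) := by
        calc c ^ 63 * (Fintype.card F * Δ ^ 63) = Fintype.card F * u ^ 63 := by rw [hu]; ring
          _ ≤ _ := h1
          _ ≤ 4 ^ 160 * 8 ^ 51 * (Fintype.card F * Δ ^ 95) := by gcongr
          _ ≤ _ := by
            gcongr 4 ^ 160 * 8 ^ 51 * (_ * ?_)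
            exact pow_le_pow_of_le_one hΔ0.le hΔ1 (by norm_num)
      have h3 := le_of_mul_le_mul_right h2 (by positivity)
      have h4 := (hcj 63).trans h3
      norm_num at h4
    · have h2 := hsub G hGt d x1
      have h3 : (D.card : ℝ) ≤ C * max ((Nat.card G : ℝ) ^ ((1:ℝ)/2)) ((A.card : ℝ) ^ ((51:ℝ)/52)) :=
        le_trans (by exact_mod_cast D_in A D x1 d hd hD1 G hG1) h2
      have h4 : u ^ 2 * A.card / 64 ≤ D.card := he2.trans hD2
      rcases le_total ((Nat.card G : ℝ) ^ ((1:ℝ)/2)) ((A.card : ℝ) ^ ((51:ℝ)/52)) with hmx | hmx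
      · rw [max_eq_right hmx] at h3
        have h5 : c ^ 2 * (A.card * Δ ^ 2) ≤ 64 * C * (A.card * Δ ^ 2) := by
          have : C * (A.card : ℝ) ^ ((51:ℝ)/52) ≤ C * (A.card * Δ ^ 2) := by gcongr
          calc _ = 64 * (u ^ 2 * A.card / 64) := by rw [hu]; ring
            _ ≤ 64 * (C * (A.card * Δ ^ 2)) := by linarith
            _ = _ := by ring
        have h6 := le_of_mul_le_mul_right h5 (by positivity)
        nlinarith
      · rw [max_eq_left hmx] at h3
        have h5 : (u ^ 2 * A.card / 64) ^ 2 ≤ C ^ 2 * Nat.card G := by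
          calc _ ≤ (C * (Nat.card G : ℝ) ^ ((1:ℝ)/2)) ^ 2 := by
                gcongr
                exact h4.trans h3
            _ = _ := by
              rw [mul_pow, ← Real.sqrt_eq_rpow, Real.sq_sqrt (by positivity)]
        have h6 : A.card * u ^ 67 ≤ C ^ 2 * (64 ^ 2 * (4 ^ 160 * 8 ^ 51)) := by
          apply le_of_mul_le_mul_right _ hAp
          calc A.card * u ^ 67 * A.card = 64 ^ 2 * (u ^ 2 * A.card / 64) ^ 2 * u ^ 63 := by ring
            _ ≤ 64 ^ 2 * (C ^ 2 * Nat.card G) * u ^ 63 := by gcongr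
            _ = 64 ^ 2 * C ^ 2 * (Nat.card G * u ^ 63) := by ring
            _ ≤ 64 ^ 2 * C ^ 2 * (4 ^ 160 * 8 ^ 51 * A.card) := by gcongr
            _ = _ := by ring
        have h7 := (hpw 67 (by norm_num)).trans h6
        have h8 : C ^ 2 * (256 ^ 2 * 256 ^ 65) ≤ C ^ 2 * (64 ^ 2 * (4 ^ 160 * 8 ^ 51)) := by
          refine le_trans ?_ h7
          calc C ^ 2 * (256 ^ 2 * 256 ^ 65) = (256 * C) ^ 2 * 256 ^ 65 := by ring
            _ ≤ c ^ 2 * c ^ 65 := by gcongr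
            _ = c ^ 67 := by ring
        have h9 := le_of_mul_le_mul_left h8 (by positivity)
        norm_num at h9

lemma sum_rich {ι : Type} (S : Finset ι) (ρ : ι → ℕ) (s t : ℝ) (hs : 0 < s) (ht : 0 < t)
    (hS : (S.card : ℝ) ≤ s ^ 3)
    (hT : ∀ k : ℕ, 2 ≤ k → ((S.filter (fun l => k ≤ ρ l)).card : ℝ) * (k : ℝ) ^ 3 ≤ t ^ 3) :
    ∑ l ∈ S, (ρ l : ℝ) ≤ s ^ 3 + 2 * t * s ^ 2 := by
  obtain ⟨k, hk⟩ : ∃ k : ℕ, k = ⌈t / s⌉₊ := ⟨_, rfl⟩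
  have hkp : 0 < k := by rw [hk]; exact Nat.ceil_pos.2 (by positivity)
  have hkp' : (0 : ℝ) < k := by exact_mod_cast hkp
  have hk1 : t / s ≤ k := by rw [hk]; exact Nat.le_ceil _
  have hk2 : (k : ℝ) ≤ t / s + 1 := by rw [hk]; exact (Nat.ceil_lt_add_one (by positivity)).le
  obtain ⟨M, hM, hkM⟩ : ∃ M : ℕ, (∀ l ∈ S, ρ l ≤ M) ∧ k ≤ M :=
    ⟨max k (S.sup ρ), fun l hl => (Finset.le_sup hl).trans (le_max_right _ _), le_max_left _ _⟩
  have h1 : ∀ l ∈ S, ρ l ≤ k + ((Finset.Ioc k M).filter (fun j => j ≤ ρ l)).card := by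
    intro l hl
    have : Finset.Ioc k (ρ l) ⊆ (Finset.Ioc k M).filter (fun j => j ≤ ρ l) := by
      intro j hj
      rw [Finset.mem_Ioc] at hj
      exact Finset.mem_filter.2 ⟨Finset.mem_Ioc.2 ⟨hj.1, hj.2.trans (hM l hl)⟩, hj.2⟩
    have := Finset.card_le_card this
    rw [Nat.card_Ioc] at this
    omega
  have h2 : ∑ l ∈ S, ρ l ≤ S.card * k + ∑ j ∈ Finset.Ioc k M, (S.filter (fun l => j ≤ ρ l)).card := by
    refine (Finset.sum_le_sum h1).trans ?_
    rw [Finset.sum_add_distrib, Finset.sum_const, smul_eq_mul]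
    apply Nat.add_le_add_left
    simp only [Finset.card_filter]
    rw [Finset.sum_comm]
  have h3 : ∑ j ∈ Finset.Ioc k M, ((S.filter (fun l => j ≤ ρ l)).card : ℝ) ≤
      ∑ j ∈ Finset.Ioc k M, t ^ 3 / k * ((j : ℝ) ^ 2)⁻¹ := by
    apply Finset.sum_le_sum
    intro j hj
    rw [Finset.mem_Ioc] at hj
    have hjp : (0 : ℝ) < j := by exact_mod_cast (by omega : 0 < j)
    have hjk : (k : ℝ) ≤ j := by exact_mod_cast hj.1.le
    have h := hT j (by omega)
    rw [← div_eq_mul_inv, div_div, le_div_iff₀ (by positivity)]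
    refine le_trans ?_ h
    gcongr
    calc (k : ℝ) * (j : ℝ) ^ 2 ≤ j * (j : ℝ) ^ 2 := by gcongr
      _ = _ := by ring
  have h4 : ∑ j ∈ Finset.Ioc k M, ((j : ℝ) ^ 2)⁻¹ ≤ (k : ℝ)⁻¹ := by
    refine (sum_Ioc_inv_sq_le_sub hkp.ne' hkM).trans ?_
    have : (0 : ℝ) ≤ (M : ℝ)⁻¹ := by positivity
    linarith
  rw [← Finset.mul_sum] at h3
  have h5 : t ^ 3 / k * (k : ℝ)⁻¹ ≤ t * s ^ 2 := by
    rw [div_le_iff₀ hs] at hk1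
    rw [← div_eq_mul_inv, div_div, div_le_iff₀ (by positivity)]
    calc t ^ 3 = t * (t * t) := by ring
      _ ≤ t * ((k * s) * (k * s)) := by gcongr
      _ = _ := by ring
  have h6 : (S.card : ℝ) * k ≤ s ^ 3 * (t / s + 1) := by gcongr
  have h7 : s ^ 3 * (t / s + 1) = t * s ^ 2 + s ^ 3 := by field_simp
  have h8 : t ^ 3 / k * ∑ j ∈ Finset.Ioc k M, ((j : ℝ) ^ 2)⁻¹ ≤ t ^ 3 / k * (k : ℝ)⁻¹ := by gcongr
  have h9 : ∑ l ∈ S, (ρ l : ℝ) ≤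
    S.card * k + ∑ j ∈ Finset.Ioc k M, ((S.filter (fun l => j ≤ ρ l)).card : ℝ) := by exact_mod_cast h2
  linarith

lemma sum_vert {ι : Type} (S : Finset ι) (ρ : ι → ℕ) (A : Finset F) (c : ι → F)
    (hinj : ∀ l ∈ S, ∀ l' ∈ S, c l = c l' → l = l')
    (hρ : ∀ l ∈ S, ρ l ≤ A.card) (hρ0 : ∀ l ∈ S, c l ∉ A → ρ l = 0)
    (a s : ℝ) (ha : 0 < a) (hs : 0 < s) (hA : (A.card : ℝ) = a ^ 3) (hS : (S.card : ℝ) ≤ s ^ 3) :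
    ∑ l ∈ S, (ρ l : ℝ) ≤ A.card * (a * s ^ 2) := by
  have h1 : ∑ l ∈ S, ρ l ≤ (S.filter (fun l => c l ∈ A)).card * A.card := by
    rw [← smul_eq_mul, ← Finset.sum_const, Finset.sum_filter]
    apply Finset.sum_le_sum
    intro l hl
    split_ifs with h
    · exact hρ l hl
    · exact (hρ0 l hl h).le
  have h2 : (S.filter (fun l => c l ∈ A)).card ≤ A.card := by
    apply Finset.card_le_card_of_injOn c
    · intro l hl
      exact (Finset.mem_filter.1 hl).2
    · intro l hl l' hl' h
      exact hinj l (Finset.mem_filter.1 hl).1 l' (Finset.mem_filter.1 hl').1 h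
  have h3 : (S.filter (fun l => c l ∈ A)).card ≤ S.card := Finset.card_filter_le _ _
  have h2' : ((S.filter (fun l => c l ∈ A)).card : ℝ) ≤ a ^ 3 := by rw [← hA]; exact_mod_cast h2
  have h3' : ((S.filter (fun l => c l ∈ A)).card : ℝ) ≤ s ^ 3 := le_trans (by exact_mod_cast h3) hS
  have h4 : ((S.filter (fun l => c l ∈ A)).card : ℝ) ≤ a * s ^ 2 := by
    rcases le_total a s with h | h
    · calc _ ≤ a ^ 3 := h2'
        _ = a * (a * a) := by ring
        _ ≤ a * (s * s) := by gcongr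
        _ = _ := by ring
    · calc _ ≤ s ^ 3 := h3'
        _ = s * s ^ 2 := by ring
        _ ≤ _ := by gcongr
  calc ∑ l ∈ S, (ρ l : ℝ) ≤ ((S.filter (fun l => c l ∈ A)).card : ℝ) * A.card := by exact_mod_cast h1
    _ ≤ a * s ^ 2 * A.card := by gcongr
    _ = _ := by ring

def IsV (l : Set (F × F)) : Prop := ∃ c : F, l = {p | p.1 = c}
def IsH (l : Set (F × F)) : Prop := ∃ c : F, l = {p | p.2 = c}

lemma line_cases (l : Set (F × F)) (hl : IsLine l) (hV : ¬ IsV l) (hH : ¬ IsH l) :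
    ∃ st : F × F, st.1 ≠ 0 ∧ l = {p | p.1 = st.1 * p.2 + st.2} := by
  obtain ⟨a, b, c, hab, rfl⟩ := hl
  by_cases ha : a = 0
  · exfalso
    have hb : b ≠ 0 := fun hb => hab (by rw [ha, hb])
    apply hH
    refine ⟨c / b, ?_⟩
    ext p
    simp only [Set.mem_ofPred_eq, ha]
    rw [eq_div_iff hb]
    constructor <;> intro h <;> linear_combination h
  by_cases hb : b = 0
  · exfalso
    apply hV
    refine ⟨c / a, ?_⟩
    ext p
    simp only [Set.mem_ofPred_eq, hb]
    rw [eq_div_iff ha]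
    constructor <;> intro h <;> linear_combination h
  · refine ⟨(-b / a, c / a), div_ne_zero (neg_ne_zero.2 hb) ha, ?_⟩
    ext p
    simp only [Set.mem_ofPred_eq]
    constructor
    · intro h
      field_simp
      linear_combination h
    · intro h
      field_simp at h
      linear_combination h

lemma line_count (A : Finset F) (s t : F) :
    ((A ×ˢ A).filter (fun p => p ∈ {p : F × F | p.1 = s * p.2 + t})).card =
      (A.filter (fun y => s * y + t ∈ A)).card := by
  apply Finset.card_bij (fun p _ => p.2)
  · intro p hp
    simp only [Finset.mem_filter, Finset.mem_product, Set.mem_ofPred_eq] at hp ⊢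
    exact ⟨hp.1.2, hp.2 ▸ hp.1.1⟩
  · intro p hp p' hp' h
    simp only [Finset.mem_filter, Finset.mem_product, Set.mem_ofPred_eq] at hp hp'
    exact Prod.ext (by rw [hp.2, hp'.2, h]) h
  · intro y hy
    rw [Finset.mem_filter] at hy
    refine ⟨(s * y + t, y), ?_, rfl⟩
    simp only [Finset.mem_filter, Finset.mem_product, Set.mem_ofPred_eq]
    exact ⟨⟨hy.2, hy.1⟩, trivial⟩

lemma incid_main [Fintype F] (A : Finset F) (a s t : ℝ) (ha : 0 < a) (hs : 0 < s) (ht : 0 < t)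
    (hA : (A.card : ℝ) = a ^ 3)
    (hT : ∀ (L : Finset (F × F)) (k : ℕ), 2 ≤ k →
      (∀ l ∈ L, k ≤ (A.filter (fun y => l.1 * y + l.2 ∈ A)).card) → (∀ l ∈ L, l.1 ≠ 0) →
      (L.card : ℝ) * (k : ℝ) ^ 3 ≤ t ^ 3)
    (L : Finset (Set (F × F))) (hL : ∀ l ∈ L, IsLine l) (hLs : (L.card : ℝ) = s ^ 3) :
    (incidences (A ×ˢ A) L : ℝ) ≤ 2 * (A.card * (a * s ^ 2)) + (s ^ 3 + 2 * t * s ^ 2) := by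
  obtain ⟨ρ, hρ⟩ : ∃ ρ : Set (F × F) → ℕ, ∀ l, ρ l = ((A ×ˢ A).filter (fun p => p ∈ l)).card :=
    ⟨_, fun _ => rfl⟩
  have h0 : incidences (A ×ˢ A) L = ∑ l ∈ L, ρ l := by
    have e1 := card_filter_prod (A ×ˢ A) L (fun p l => p ∈ l)
    have e2 := double_count (A ×ˢ A) L (fun p l => p ∈ l)
    rw [e2] at e1
    unfold incidences
    simp only [hρ]
    convert e1
  have h1 : ∑ l ∈ L, (ρ l : ℝ) = ∑ l ∈ L.filter IsV, (ρ l : ℝ) +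
      (∑ l ∈ (L.filter (fun l => ¬ IsV l)).filter IsH, (ρ l : ℝ) +
       ∑ l ∈ (L.filter (fun l => ¬ IsV l)).filter (fun l => ¬ IsH l), (ρ l : ℝ)) := by
    rw [Finset.sum_filter_add_sum_filter_not, Finset.sum_filter_add_sum_filter_not]
  have hsubs : ∀ S ⊆ L, (S.card : ℝ) ≤ s ^ 3 := by
    intro S hS
    rw [← hLs]
    exact_mod_cast Finset.card_le_card hS
  have hV : ∑ l ∈ L.filter IsV, (ρ l : ℝ) ≤ A.card * (a * s ^ 2) := by
    have : ∀ l : Set (F × F), ∃ c : F, IsV l → l = {p | p.1 = c} := by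
      intro l
      by_cases h : IsV l
      · obtain ⟨c, hc⟩ := h
        exact ⟨c, fun _ => hc⟩
      · exact ⟨0, fun h' => absurd h' h⟩
    choose c hc using this
    apply sum_vert _ ρ A c _ _ _ a s ha hs hA (hsubs _ (Finset.filter_subset _ _))
    · intro l hl l' hl' h
      rw [hc l (Finset.mem_filter.1 hl).2, hc l' (Finset.mem_filter.1 hl').2, h]
    · intro l hl
      rw [hρ]
      apply Finset.card_le_card_of_injOn (fun p => p.2)
      · intro p hp
        simp only [Finset.coe_filter, Set.mem_ofPred_eq, Finset.mem_product] at hp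
        exact hp.1.2
      · intro p hp p' hp' h
        simp only [Finset.coe_filter, Set.mem_ofPred_eq] at hp hp'
        have e1 := hp.2
        have e2 := hp'.2
        rw [hc l (Finset.mem_filter.1 hl).2] at e1 e2
        exact Prod.ext (e1.trans e2.symm) h
    · intro l hl hcl
      rw [hρ, Finset.card_eq_zero, Finset.filter_eq_empty_iff]
      intro p hp hpl
      rw [hc l (Finset.mem_filter.1 hl).2] at hpl
      have e1 : p.1 = c l := hpl
      exact hcl (e1 ▸ (Finset.mem_product.1 hp).1)
  have hH : ∑ l ∈ (L.filter (fun l => ¬ IsV l)).filter IsH, (ρ l : ℝ) ≤ A.card * (a * s ^ 2) := by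
    have : ∀ l : Set (F × F), ∃ c : F, IsH l → l = {p | p.2 = c} := by
      intro l
      by_cases h : IsH l
      · obtain ⟨c, hc⟩ := h
        exact ⟨c, fun _ => hc⟩
      · exact ⟨0, fun h' => absurd h' h⟩
    choose c hc using this
    apply sum_vert _ ρ A c _ _ _ a s ha hs hA
      (hsubs _ ((Finset.filter_subset _ _).trans (Finset.filter_subset _ _)))
    · intro l hl l' hl' h
      rw [hc l (Finset.mem_filter.1 hl).2, hc l' (Finset.mem_filter.1 hl').2, h]
    · intro l hl
      rw [hρ]
      apply Finset.card_le_card_of_injOn (fun p => p.1)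
      · intro p hp
        simp only [Finset.coe_filter, Set.mem_ofPred_eq, Finset.mem_product] at hp
        exact hp.1.1
      · intro p hp p' hp' h
        simp only [Finset.coe_filter, Set.mem_ofPred_eq] at hp hp'
        have e1 := hp.2
        have e2 := hp'.2
        rw [hc l (Finset.mem_filter.1 hl).2] at e1 e2
        exact Prod.ext h (e1.trans e2.symm)
    · intro l hl hcl
      rw [hρ, Finset.card_eq_zero, Finset.filter_eq_empty_iff]
      intro p hp hpl
      rw [hc l (Finset.mem_filter.1 hl).2] at hpl
      have e1 : p.2 = c l := hpl
      exact hcl (e1 ▸ (Finset.mem_product.1 hp).2)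
  have hS : ∑ l ∈ (L.filter (fun l => ¬ IsV l)).filter (fun l => ¬ IsH l), (ρ l : ℝ) ≤
      s ^ 3 + 2 * t * s ^ 2 := by
    have : ∀ l : Set (F × F), ∃ st : F × F, (l ∈ (L.filter (fun l => ¬ IsV l)).filter (fun l => ¬ IsH l)) →
        st.1 ≠ 0 ∧ l = {p | p.1 = st.1 * p.2 + st.2} := by
      intro l
      by_cases h : l ∈ (L.filter (fun l => ¬ IsV l)).filter (fun l => ¬ IsH l)
      · have h' := h
        rw [Finset.mem_filter, Finset.mem_filter] at h'
        obtain ⟨st, hst⟩ := line_cases l (hL l h'.1.1) h'.1.2 h'.2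
        exact ⟨st, fun _ => hst⟩
      · exact ⟨0, fun h' => absurd h' h⟩
    choose f hf using this
    apply sum_rich _ ρ s t hs ht
      (hsubs _ ((Finset.filter_subset _ _).trans (Finset.filter_subset _ _)))
    intro k hk
    generalize (L.filter (fun l => ¬ IsV l)).filter (fun l => ¬ IsH l) = S at hf
    have hinj : Set.InjOn f (S.filter (fun l => k ≤ ρ l)) := by
      intro l hl l' hl' h
      rw [(hf l (Finset.mem_filter.1 hl).1).2, (hf l' (Finset.mem_filter.1 hl').1).2, h]
    have e := Finset.card_image_of_injOn hinj
    rw [← e]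
    apply hT _ k hk
    · intro st hst
      obtain ⟨l, hl, rfl⟩ := Finset.mem_image.1 hst
      rw [Finset.mem_filter] at hl
      have h2 := hl.2
      rw [hρ, (hf l hl.1).2] at h2
      have h3 := line_count A (f l).1 (f l).2
      refine h2.trans (le_of_eq ?_)
      convert h3
    · intro st hst
      obtain ⟨l, hl, rfl⟩ := Finset.mem_image.1 hst
      exact (hf l (Finset.mem_filter.1 hl).1).1
  have h0' : (incidences (A ×ˢ A) L : ℝ) = ∑ l ∈ L, (ρ l : ℝ) := by exact_mod_cast h0
  rw [h0', h1]
  linarith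

lemma numeric (N q K : ℝ) (hN1 : 1 ≤ N) (hNq : N ≤ q) (hK1 : 1 ≤ K) :
    ∃ Δ : ℝ, 0 < Δ ∧ Δ ≤ 1 ∧ 1 ≤ N * Δ ^ 104 ∧ N ≤ q * Δ ^ 95 ∧ N ^ ((51:ℝ)/52) ≤ N * Δ ^ 2 ∧
      K * N ^ 5 * Δ ≤ (K * (N ^ ((173:ℝ)/104) + q ^ (-(1:ℝ)/285) * N ^ ((476:ℝ)/285))) ^ 3 := by
  have hNp : 0 < N := by linarith
  have hqp : 0 < q := by linarith
  obtain ⟨X1, hX1⟩ : ∃ X : ℝ, X = N ^ ((173:ℝ)/104) := ⟨_, rfl⟩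
  obtain ⟨X2, hX2⟩ : ∃ X : ℝ, X = q ^ (-(1:ℝ)/285) * N ^ ((476:ℝ)/285) := ⟨_, rfl⟩
  have hX1p : 0 < X1 := by rw [hX1]; positivity
  have hX2p : 0 < X2 := by rw [hX2]; positivity
  have hX13 : N ^ 5 * N ^ (-(1:ℝ)/104) = X1 ^ 3 := by
    rw [hX1, ← Real.rpow_natCast, ← Real.rpow_natCast, ← Real.rpow_mul hNp.le, ← Real.rpow_add hNp]
    norm_num
  have hX23 : N ^ 5 * (N / q) ^ ((1:ℝ)/95) = X2 ^ 3 := by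
    rw [hX2, mul_pow, Real.div_rpow hNp.le hqp.le, div_eq_mul_inv, ← Real.rpow_neg hqp.le,
      ← Real.rpow_natCast, ← Real.rpow_natCast, ← Real.rpow_natCast, ← Real.rpow_mul hNp.le,
      ← Real.rpow_mul hqp.le, ← mul_assoc, ← Real.rpow_add hNp]
    norm_num
    ring
  obtain ⟨D1, hD1⟩ : ∃ X : ℝ, X = N ^ (-(1:ℝ)/104) := ⟨_, rfl⟩
  obtain ⟨D2, hD2⟩ : ∃ X : ℝ, X = (N / q) ^ ((1:ℝ)/95) := ⟨_, rfl⟩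
  have hD1p : 0 < D1 := by rw [hD1]; positivity
  have hD2p : 0 < D2 := by rw [hD2]; positivity
  have hD1l : D1 ≤ 1 := by rw [hD1]; exact Real.rpow_le_one_of_one_le_of_nonpos hN1 (by norm_num)
  have hD2l : D2 ≤ 1 := by
    rw [hD2]; exact Real.rpow_le_one (by positivity) ((div_le_one hqp).2 hNq) (by norm_num)
  have hD1a : 1 = N * D1 ^ 104 := by
    rw [hD1, ← Real.rpow_natCast, ← Real.rpow_mul hNp.le]
    norm_num
    rw [Real.rpow_neg_one, mul_inv_cancel₀ hNp.ne']
  have hD2a : N = q * D2 ^ 95 := by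
    rw [hD2, ← Real.rpow_natCast, ← Real.rpow_mul (by positivity)]
    norm_num
    field_simp
  have hD1b : N ^ ((51:ℝ)/52) = N * D1 ^ 2 := by
    rw [hD1, ← Real.rpow_natCast, ← Real.rpow_mul hNp.le]
    nth_rewrite 2 [← Real.rpow_one N]
    rw [← Real.rpow_add hNp]
    norm_num
  refine ⟨max D1 D2, lt_max_of_lt_left hD1p, max_le hD1l hD2l,
    hD1a.le.trans ?_, hD2a.le.trans ?_, hD1b.le.trans ?_, ?_⟩
  · have := le_max_left D1 D2
    gcongr
  · have := le_max_right D1 D2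
    gcongr
  · have := le_max_left D1 D2
    gcongr
  rw [← hX1, ← hX2]
  have h1 : N ^ 5 * max D1 D2 ≤ (X1 + X2) ^ 3 := by
    rcases le_total D1 D2 with h | h
    · rw [max_eq_right h, hD2, hX23]
      gcongr
      linarith
    · rw [max_eq_left h, hD1, hX13]
      gcongr
      linarith
  have h2 : K ≤ K ^ 3 := le_self_pow₀ hK1 (by norm_num)
  rw [mul_assoc, mul_pow]
  gcongr

theorem stmt4 : ∀ C : ℝ, 0 < C → ∃ C' : ℝ, 0 < C' ∧
    ∀ (F : Type) [Field F] [Fintype F] (q : ℕ), IsPrimePow q → Fintype.card F = q →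
    ∀ A : Finset F, 2 ≤ A.card →
    subfieldCond A C ((A.card : ℝ) ^ ((51:ℝ)/52)) →
    ∀ L : Finset (Set (F × F)), (∀ l ∈ L, IsLine l) →
    (incidences (A ×ˢ A) L : ℝ) ≤
      C' * (((A.card : ℝ) ^ ((173:ℝ)/104)
        + (q : ℝ) ^ (-(1:ℝ)/285) * (A.card : ℝ) ^ ((476:ℝ)/285)) * (L.card : ℝ) ^ ((2:ℝ)/3)
        + (L.card : ℝ)) := by
  intro C hC
  obtain ⟨K, hK⟩ : ∃ K : ℝ, K = 2 * (256 * (1 + C)) := ⟨_, rfl⟩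
  have hK1 : 1 ≤ K := by rw [hK]; linarith
  refine ⟨2 + 2 * K, by linarith, ?_⟩
  intro F _ _ q _ hq A hA2 hsub L hL
  rcases L.eq_empty_or_nonempty with rfl | hLne
  · have : incidences (A ×ˢ A) (∅ : Finset (Set (F × F))) = 0 := by simp [incidences]
    rw [this]
    push_cast
    positivity
  have hAne : A.Nonempty := Finset.card_pos.1 (by omega)
  have hNq : (A.card : ℝ) ≤ q := by
    rw [← hq]
    exact_mod_cast Finset.card_le_univ A
  have hN1 : (1 : ℝ) ≤ A.card := by exact_mod_cast (by omega : 1 ≤ A.card)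
  have hbase : ∀ Δ : ℝ, 0 < Δ → Δ ≤ 1 → 1 ≤ (A.card : ℝ) * Δ ^ 104 →
      (A.card : ℝ) ≤ Fintype.card F * Δ ^ 95 → (A.card : ℝ) ^ ((51:ℝ)/52) ≤ A.card * Δ ^ 2 →
      ∀ (L : Finset (F × F)) (k : ℕ), 2 ≤ k →
      (∀ l ∈ L, k ≤ (A.filter (fun y => l.1 * y + l.2 ∈ A)).card) → (∀ l ∈ L, l.1 ≠ 0) →
      (L.card : ℝ) * (k : ℝ) ^ 3 ≤ K * (A.card : ℝ) ^ 5 * Δ := by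
    intro Δ h1 h2 h3 h4 h5 L k hk2 hk hL0
    rw [hK]
    exact rich_bound C hC A hAne hsub Δ h1 h2 h3 h4 h5 L k hk2 hk hL0
  have hmain := incid_main A
  have hcardq : (Fintype.card F : ℝ) = q := by exact_mod_cast hq
  rw [hcardq] at hbase
  clear hsub
  obtain ⟨s, hs⟩ : ∃ s : ℝ, s = (L.card : ℝ) ^ ((1:ℝ)/3) := ⟨_, rfl⟩
  obtain ⟨a, ha⟩ : ∃ a : ℝ, a = (A.card : ℝ) ^ ((1:ℝ)/3) := ⟨_, rfl⟩
  have hLp : (0 : ℝ) < L.card := by exact_mod_cast hLne.card_pos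
  have hNp : (0 : ℝ) < A.card := by linarith
  have hqp : (0 : ℝ) < q := by linarith
  have hsp : 0 < s := by rw [hs]; positivity
  have hap : 0 < a := by rw [ha]; positivity
  have hs3 : (L.card : ℝ) = s ^ 3 := by
    rw [hs, ← Real.rpow_natCast, ← Real.rpow_mul hLp.le]; norm_num
  have hs2 : (L.card : ℝ) ^ ((2:ℝ)/3) = s ^ 2 := by
    rw [hs, ← Real.rpow_natCast, ← Real.rpow_mul hLp.le]; norm_num
  have ha3 : (A.card : ℝ) = a ^ 3 := by
    rw [ha, ← Real.rpow_natCast, ← Real.rpow_mul hNp.le]; norm_num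
  rw [hs2]
  have hNa : (A.card : ℝ) * a ≤ (A.card : ℝ) ^ ((173:ℝ)/104) := by
    calc (A.card : ℝ) * a = (A.card : ℝ) ^ ((1:ℝ) + 1/3) := by
          rw [Real.rpow_add hNp, Real.rpow_one, ha]
      _ ≤ _ := Real.rpow_le_rpow_of_exponent_le hN1 (by norm_num)
  obtain ⟨Δ, e1, e2, e3, e4, e5, hX⟩ := numeric (A.card : ℝ) q K hN1 hNq hK1
  have hb := hbase Δ e1 e2 e3 e4 e5
  have hXp : 0 < (A.card : ℝ) ^ ((173:ℝ)/104) := Real.rpow_pos_of_pos hNp _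
  have hXp2 : 0 < (q : ℝ) ^ (-(1:ℝ)/285) * (A.card : ℝ) ^ ((476:ℝ)/285) :=
    mul_pos (Real.rpow_pos_of_pos hqp _) (Real.rpow_pos_of_pos hNp _)
  clear hbase e1 e2 e3 e4 e5
  generalize (A.card : ℝ) ^ ((173:ℝ)/104) = X1 at *
  generalize (q : ℝ) ^ (-(1:ℝ)/285) * (A.card : ℝ) ^ ((476:ℝ)/285) = X2 at *
  have hfin := hmain a s (K * (X1 + X2)) hap hsp (mul_pos (by linarith) (by linarith)) ha3
    (fun L k h1 h2 h3 => (hb L k h1 h2 h3).trans hX) L hL hs3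
  rw [hs3]
  refine hfin.trans ?_
  have hs2p : 0 < s ^ 2 := pow_pos hsp 2
  have h1 : (A.card : ℝ) * (a * s ^ 2) ≤ (X1 + X2) * s ^ 2 := by
    rw [← mul_assoc]
    exact mul_le_mul_of_nonneg_right (by linarith) hs2p.le
  have h2 : s ^ 3 ≤ (2 + 2 * K) * s ^ 3 := le_mul_of_one_le_left (pow_pos hsp 3).le (by linarith)
  linarith

end STP
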